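/- arXiv:2201.00547 — 3 statements merged into one kernel-verified Lean document; each statement's English description precedes it below -/
import Mathlib

section
/- For every integer k ≥ 3 and every real c > 0 there exists n₀ such that for every integer n ≥ n₀, every set A of n distinct real numbers satisfying the (k, k)-local property has |A - A| > c·n. (That is, g(n,k,k) = ω(n).) -/
open Finset Pointwise

/-- The (positive) difference set of a finite set of reals:
`A - A = {a - a' : a, a' ∈ A, a - a' > 0}`. -/
noncomputable def diffSet (A : Finset ℝ) : Finset ℝ := (A - A).filter (fun x => 0 < x)

/-- `A` satisfies the `(k, ℓ)`-local property: every `k`-element subset `A'` of `A`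
spans at least `ℓ` positive differences. -/
def LocalProp (A : Finset ℝ) (k ℓ : ℕ) : Prop :=
  ∀ A' ⊆ A, A'.card = k → ℓ ≤ (diffSet A').card

/-- The average of a real function over a finite type. -/
noncomputable def avg {X : Type*} (f : X → ℝ) : ℝ := (∑ᶠ x, f x) / Nat.card X

/-- The density of a set in a finite type. -/
noncomputable def density {X : Type*} (E : Set X) : ℝ := avg (E.indicator fun _ => 1)

section Average

variable {X Y Z : Type*}

lemma avg_eq_sum [Fintype X] (f : X → ℝ) : avg f = (∑ x, f x) / Fintype.card X := by
  rw [avg, finsum_eq_sum_of_fintype, Nat.card_eq_fintype_card]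

lemma avg_mono [Finite X] {f g : X → ℝ} (h : ∀ x, f x ≤ g x) : avg f ≤ avg g := by
  cases nonempty_fintype X
  rw [avg_eq_sum, avg_eq_sum]
  gcongr
  exact h _

lemma avg_add [Finite X] (f g : X → ℝ) : avg (fun x => f x + g x) = avg f + avg g := by
  cases nonempty_fintype X
  simp only [avg_eq_sum, sum_add_distrib, add_div]

lemma avg_sub [Finite X] (f g : X → ℝ) : avg (fun x => f x - g x) = avg f - avg g := by
  cases nonempty_fintype X
  simp only [avg_eq_sum, sum_sub_distrib, sub_div]

lemma avg_const_mul [Finite X] (c : ℝ) (f : X → ℝ) : avg (fun x => c * f x) = c * avg f := by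
  cases nonempty_fintype X
  simp only [avg_eq_sum, ← mul_sum, mul_div_assoc]

lemma avg_const [Finite X] [Nonempty X] (c : ℝ) : avg (fun _ : X => c) = c := by
  cases nonempty_fintype X
  simp [avg_eq_sum]

lemma avg_nonneg {f : X → ℝ} (h : ∀ x, 0 ≤ f x) : 0 ≤ avg f :=
  div_nonneg (finsum_nonneg h) (Nat.cast_nonneg _)

lemma avg_nonpos [Finite X] {f : X → ℝ} (h : ∀ x, f x ≤ 0) : avg f ≤ 0 := by
  cases nonempty_fintype X
  rw [avg_eq_sum]
  exact div_nonpos_of_nonpos_of_nonneg (sum_nonpos fun x _ => h x) (Nat.cast_nonneg _)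

lemma avg_le_of_le [Finite X] [Nonempty X] {f : X → ℝ} {c : ℝ} (h : ∀ x, f x ≤ c) :
    avg f ≤ c := (avg_mono h).trans_eq (avg_const c)

lemma le_avg_of_le [Finite X] [Nonempty X] {f : X → ℝ} {c : ℝ} (h : ∀ x, c ≤ f x) :
    c ≤ avg f := (avg_const c).symm.trans_le (avg_mono h)

lemma exists_le_of_le_avg [Finite X] [Nonempty X] {f : X → ℝ} {c : ℝ} (h : c ≤ avg f) :
    ∃ x, c ≤ f x := by
  by_contra! hlt
  cases nonempty_fintype X
  rw [avg_eq_sum, le_div_iff₀ (by exact_mod_cast Fintype.card_pos)] at h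
  have := sum_lt_sum_of_nonempty (univ_nonempty (α := X)) fun x _ => hlt x
  simp only [sum_const, card_univ, nsmul_eq_mul] at this
  linarith

lemma avg_comp_equiv (e : X ≃ Y) (f : Y → ℝ) : avg (fun x => f (e x)) = avg f := by
  rw [avg, avg, Nat.card_congr e, finsum_comp_equiv e]

lemma avg_prod [Finite X] [Finite Y] (f : X × Y → ℝ) :
    avg f = avg fun x => avg fun y => f (x, y) := by
  cases nonempty_fintype X
  cases nonempty_fintype Y
  simp only [avg_eq_sum, Fintype.sum_prod_type, Fintype.card_prod, ← sum_div, div_div,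
    Nat.cast_mul, mul_comm (Fintype.card X : ℝ)]

lemma avg_comm [Finite X] [Finite Y] (f : X → Y → ℝ) :
    (avg fun x => avg fun y => f x y) = avg fun y => avg fun x => f x y := by
  rw [← avg_prod fun p : X × Y => f p.1 p.2, ← avg_prod fun p : Y × X => f p.2 p.1,
    ← avg_comp_equiv (Equiv.prodComm X Y)]
  rfl

lemma avg_finset_sum [Finite X] {I : Type*} (s : Finset I) (f : I → X → ℝ) :
    avg (fun x => ∑ i ∈ s, f i x) = ∑ i ∈ s, avg (f i) := by
  cases nonempty_fintype X
  simp only [avg_eq_sum, sum_div]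
  rw [sum_comm]

lemma density_nonneg (E : Set X) : 0 ≤ density E :=
  avg_nonneg fun _ => Set.indicator_nonneg (fun _ _ => zero_le_one) _

lemma density_le_one [Finite X] (E : Set X) : density E ≤ 1 := by
  cases isEmpty_or_nonempty X
  · simp [density, avg]
  · exact avg_le_of_le fun x => Set.indicator_le_self' (fun _ _ => zero_le_one) x

lemma density_mono [Finite X] {E F : Set X} (h : E ⊆ F) : density E ≤ density F :=
  avg_mono fun x => Set.indicator_le_indicator_of_subset h (fun _ => zero_le_one) x

lemma density_empty : density (∅ : Set X) = 0 := by simp [density, avg]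

lemma density_comp_equiv (e : X ≃ Y) (E : Set Y) : density (e ⁻¹' E) = density E :=
  avg_comp_equiv e (E.indicator fun _ => 1)

lemma density_prod [Finite X] [Finite Y] (E : Set (X × Y)) :
    density E = avg fun x => density {y | (x, y) ∈ E} := by
  rw [density, avg_prod]
  rfl

lemma density_prod' [Finite X] [Finite Y] (E : Set (X × Y)) :
    density E = avg fun y => density {x | (x, y) ∈ E} := by
  rw [density_prod]
  exact avg_comm fun x y => E.indicator (fun _ => (1 : ℝ)) (x, y)

lemma density_singleton [Finite X] (x : X) : density {x} = 1 / Nat.card X := by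
  cases nonempty_fintype X
  classical
  rw [density, avg_eq_sum, Nat.card_eq_fintype_card]
  simp [Set.indicator_apply]

lemma avg_le_density_add [Finite X] [Nonempty X] {f : X → ℝ} (hf : ∀ x, f x ≤ 1) {c : ℝ}
    (hc : 0 ≤ c) : avg f ≤ density {x | c ≤ f x} + c := by
  have := avg_mono (f := f) (g := fun x => ({x | c ≤ f x} : Set X).indicator (fun _ => 1) x + c)
    fun x => by
      by_cases h : c ≤ f x
      · have : x ∈ {x | c ≤ f x} := h
        simp only [Set.indicator_of_mem this]
        linarith [hf x]
      · have : x ∉ {x | c ≤ f x} := h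
        simp only [Set.indicator_of_notMem this]
        linarith
  rwa [avg_add, avg_const] at this

/-- Among finitely many sets covering `E`, one has density at least the average share. -/
lemma exists_density_ge_of_cover [Finite X] {I : Type*} [Finite I] {E : Set X} {c : ℝ} (hc : 0 < c)
    (hE : c ≤ density E) (F : I → Set X) (hF : ∀ x ∈ E, ∃ i, x ∈ F i) :
    ∃ i, c / Nat.card I ≤ density (F i) := by
  cases nonempty_fintype I
  by_contra! hlt
  have hI : Nonempty I := by
    by_contra hI
    rw [not_nonempty_iff] at hI
    have : E = ∅ := Set.eq_empty_of_forall_notMem fun x hx => (hF x hx).elim fun i _ => hI.elim i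
    rw [this, density_empty] at hE
    linarith
  have h1 : density E ≤ ∑ i, density (F i) := by
    simp only [density]
    rw [← avg_finset_sum]
    refine avg_mono fun x => ?_
    by_cases hx : x ∈ E
    · obtain ⟨i, hi⟩ := hF x hx
      rw [Set.indicator_of_mem hx]
      refine (Set.indicator_of_mem hi fun _ => (1 : ℝ)).ge.trans ?_
      exact single_le_sum (f := fun i => (F i).indicator (fun _ => (1 : ℝ)) x)
        (fun i _ => Set.indicator_nonneg (fun _ _ => zero_le_one) _) (mem_univ i)
    · rw [Set.indicator_of_notMem hx]
      exact sum_nonneg fun i _ => Set.indicator_nonneg (fun _ _ => zero_le_one) _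
  have h2 := sum_lt_sum_of_nonempty (univ_nonempty (α := I)) fun i _ => hlt i
  rw [sum_const, card_univ, nsmul_eq_mul, Nat.card_eq_fintype_card,
    mul_div_cancel₀ _ (by exact_mod_cast Fintype.card_ne_zero)] at h2
  linarith

end Average

/-- A map between finite types that pushes the uniform measure to the uniform measure. -/
def Equidistributed {X Y : Type*} (Φ : X → Y) : Prop :=
  ∀ F : Y → ℝ, avg (fun x => F (Φ x)) = avg F

section Equidistributed

variable {X Y Z ι κ : Type*}

lemma Equidistributed.equiv (e : X ≃ Y) : Equidistributed e := fun F => avg_comp_equiv e F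

lemma Equidistributed.comp {Φ : Y → Z} {Ψ : X → Y} (hΦ : Equidistributed Φ)
    (hΨ : Equidistributed Ψ) : Equidistributed (Φ ∘ Ψ) := fun F =>
  (hΨ fun y => F (Φ y)).trans (hΦ F)

lemma Equidistributed.density_preimage {Φ : X → Y} (h : Equidistributed Φ) (E : Set Y) :
    density (Φ ⁻¹' E) = density E := h (E.indicator fun _ => 1)

lemma Equidistributed.fst [Finite X] [Finite Y] [Nonempty Y] :
    Equidistributed (Prod.fst : X × Y → X) := fun F => by
  rw [avg_prod]
  simp only [avg_const]

lemma avg_eq_sum_fiber [Fintype X] [Fintype Y] [DecidableEq Y] (Φ : X → Y) (F : Y → ℝ) :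
    avg (fun x => F (Φ x)) =
      ∑ y, F y * ((#{x | Φ x = y} : ℕ) / Fintype.card X : ℝ) := by
  rw [avg_eq_sum, ← sum_fiberwise univ Φ, sum_div]
  refine sum_congr rfl fun y _ => ?_
  rw [sum_congr rfl (g := fun _ => F y) fun x hx => by rw [(mem_filter.1 hx).2]]
  simp only [sum_const, nsmul_eq_mul]
  ring

lemma Equidistributed.pi [Finite ι] [Finite X] [Finite Y] {Φ : X → Y} (h : Equidistributed Φ) :
    Equidistributed fun (w : ι → X) i => Φ (w i) := by
  classical
  cases nonempty_fintype ι
  cases nonempty_fintype X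
  cases nonempty_fintype Y
  have hfib : ∀ y, (#{x | Φ x = y} : ℕ) / (Fintype.card X : ℝ) = 1 / Fintype.card Y := by
    intro y
    have := h fun z => if z = y then 1 else 0
    rw [avg_eq_sum, avg_eq_sum] at this
    simpa using this
  intro F
  rw [avg_eq_sum_fiber (fun (w : ι → X) i => Φ (w i)), avg_eq_sum, sum_div]
  refine sum_congr rfl fun v _ => ?_
  have hpi : (univ.filter fun w : ι → X => (fun i => Φ (w i)) = v) =
      Fintype.piFinset fun i => univ.filter fun x => Φ x = v i := by
    ext w
    simp [Fintype.mem_piFinset, funext_iff]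
  rw [hpi, Fintype.card_piFinset, Fintype.card_fun, Fintype.card_fun, div_eq_mul_one_div (F v)]
  push_cast
  rw [← card_univ (α := ι), ← prod_const, ← prod_const, ← prod_div_distrib, prod_congr rfl
    fun i _ => hfib (v i), prod_div_distrib, prod_const_one]

lemma Equidistributed.precomp [Finite ι] [Finite κ] [Finite X] [Nonempty X] {e : κ → ι}
    (he : Function.Injective e) : Equidistributed fun (w : ι → X) => w ∘ e := by
  classical
  let E := Equiv.ofInjective e he
  have h1 := (Equidistributed.fst (X := {i // i ∈ Set.range e} → X)
    (Y := {i // ¬ i ∈ Set.range e} → X)).comp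
      (Equidistributed.equiv (Equiv.piEquivPiSubtypeProd (fun i => i ∈ Set.range e) fun _ => X))
  exact (Equidistributed.equiv (Equiv.arrowCongr E (Equiv.refl X)).symm).comp h1

lemma avg_prod_coord [Finite ι] [Fintype X] (g : X → ℝ) :
    avg (fun w : ι → X => ∏ᶠ i, g (w i)) = avg g ^ Nat.card ι := by
  classical
  cases nonempty_fintype ι
  rw [avg_eq_sum, avg_eq_sum, div_pow, Nat.card_eq_fintype_card, Fintype.card_fun]
  simp only [finprod_eq_prod_of_fintype]
  rw [← Fintype.piFinset_univ, ← prod_univ_sum, prod_const, card_univ]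
  push_cast
  rfl

/-- In a long random word, every letter occurs many times, with high probability. -/
lemma exists_density_few_le [Finite X] (s : X) (M : ℕ) {ε : ℝ} (hε : 0 < ε) :
    ∃ N : ℕ, ∀ (ι : Type) [Finite ι], N ≤ Nat.card ι →
      density {w : ι → X | Nat.card {i // w i = s} < M} ≤ ε := by
  classical
  cases nonempty_fintype X
  have : Nonempty X := ⟨s⟩
  let g : X → ℝ := fun x => if x = s then 1 / 2 else 1
  have hg0 : ∀ x, 0 ≤ g x := fun x => by simp only [g]; split_ifs <;> norm_num
  have hgavg : avg g < 1 := by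
    rw [avg_eq_sum, div_lt_one (by exact_mod_cast Fintype.card_pos)]
    calc ∑ x, g x < ∑ _x : X, (1 : ℝ) := sum_lt_sum
          (fun x _ => by simp only [g]; split_ifs <;> norm_num) ⟨s, mem_univ s, by norm_num [g]⟩
      _ = _ := by simp
  obtain ⟨N, hN⟩ := exists_pow_lt_of_lt_one (show 0 < ε / 2 ^ M by positivity) hgavg
  refine ⟨N, fun ι _ hι => ?_⟩
  cases nonempty_fintype ι
  have hle : density {w : ι → X | Nat.card {i // w i = s} < M} ≤
      2 ^ M * avg (fun w : ι → X => ∏ᶠ i, g (w i)) := by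
    rw [← avg_const_mul]
    refine avg_mono fun w => ?_
    have hprod : ∏ᶠ i, g (w i) = (1 / 2) ^ Nat.card {i // w i = s} := by
      rw [finprod_eq_prod_of_fintype, Nat.card_eq_fintype_card, Fintype.card_subtype]
      simp only [g]
      rw [prod_ite, prod_const, prod_const_one, mul_one]
    rw [hprod]
    refine Set.indicator_apply_le' (fun hw => ?_) fun _ => by positivity
    have hw' : Nat.card {i // w i = s} ≤ M := le_of_lt hw
    calc (1 : ℝ) = 2 ^ M * (1 / 2) ^ M := by rw [← mul_pow]; norm_num
      _ ≤ _ := by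
        gcongr 2 ^ M * ?_
        exact pow_le_pow_of_le_one (by norm_num) (by norm_num) hw'
  rw [avg_prod_coord] at hle
  have hpow : avg g ^ Nat.card ι ≤ avg g ^ N :=
    pow_le_pow_of_le_one (avg_nonneg hg0) hgavg.le hι
  calc _ ≤ 2 ^ M * (ε / 2 ^ M) := hle.trans (by gcongr; exact hpow.trans hN.le)
    _ = ε := by field_simp

end Equidistributed

section Words

variable {α η κ ι : Type*}

/-- The word obtained from the pattern `φ` by substituting the letter `u e` for the
wildcard `e`. -/
def fill (φ : ι → α ⊕ η) (u : η → α) : ι → α := fun i => Sum.elim id u (φ i)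

/-- A pattern is proper if each wildcard occurs in it. -/
def IsProper (φ : ι → α ⊕ η) : Prop := ∀ e, ∃ i, φ i = Sum.inr e

/-- The set `A` of words contains a combinatorial line. -/
def HasLine (A : Set (ι → α)) : Prop :=
  ∃ p : ι → Option α, (∃ i, p i = none) ∧ ∀ a, (fun i => (p i).getD a) ∈ A

/-- The density Hales-Jewett property of an alphabet. -/
def DHJ (α : Type) : Prop :=
  ∀ δ : ℝ, 0 < δ → ∃ N : ℕ, ∀ (ι : Type) [Finite ι], N ≤ Nat.card ι →
    ∀ A : Set (ι → α), δ ≤ density A → HasLine A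

/-- The multidimensional density Hales-Jewett property of an alphabet. -/
def MultiDHJ (α : Type) : Prop :=
  ∀ (m : ℕ) (δ : ℝ), 0 < δ → ∃ N : ℕ, ∀ (ι : Type) [Finite ι], N ≤ Nat.card ι →
    ∀ A : Set (ι → α), δ ≤ density A →
      ∃ φ : ι → α ⊕ Fin m, IsProper φ ∧ ∀ u, fill φ u ∈ A

/-- Splitting words along a decomposition of the index set. -/
def wordEquiv (α : Type*) (e : κ ⊕ η ≃ ι) : (κ → α) × (η → α) ≃ (ι → α) :=
  (Equiv.sumArrowEquivProdArrow κ η α).symm.trans (Equiv.arrowCongr e (Equiv.refl α))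

@[simp] lemma wordEquiv_inl (e : κ ⊕ η ≃ ι) (p : (κ → α) × (η → α)) (i : κ) :
    wordEquiv α e p (e (Sum.inl i)) = p.1 i := by
  simp [wordEquiv, Equiv.arrowCongr, Equiv.sumArrowEquivProdArrow]

@[simp] lemma wordEquiv_inr (e : κ ⊕ η ≃ ι) (p : (κ → α) × (η → α)) (i : η) :
    wordEquiv α e p (e (Sum.inr i)) = p.2 i := by
  simp [wordEquiv, Equiv.arrowCongr, Equiv.sumArrowEquivProdArrow]

lemma eq_wordEquiv_iff (e : κ ⊕ η ≃ ι) (p : (κ → α) × (η → α)) (w : ι → α) :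
    w = wordEquiv α e p ↔
      (∀ i, w (e (Sum.inl i)) = p.1 i) ∧ ∀ i, w (e (Sum.inr i)) = p.2 i := by
  constructor
  · rintro rfl
    simp
  · rintro ⟨h1, h2⟩
    funext i
    obtain ⟨j | j, rfl⟩ := e.surjective i
    · simp [h1]
    · simp [h2]

lemma nonempty_split_equiv [Finite ι] {n : ℕ} (h : n ≤ Nat.card ι) :
    Nonempty (Fin n ⊕ Fin (Nat.card ι - n) ≃ ι) :=
  ⟨finSumFinEquiv.trans ((finCongr (by omega)).trans (Finite.equivFin ι).symm)⟩

lemma fill_injective {φ : ι → α ⊕ η} (hφ : IsProper φ) : Function.Injective (fill φ) := by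
  intro u v huv
  funext e
  obtain ⟨i, hi⟩ := hφ e
  simpa [fill, hi] using congrFun huv i

/-- Substituting a pattern into a pattern. -/
def fillPattern (φ : ι → α ⊕ η) (ψ : η → α ⊕ κ) : ι → α ⊕ κ :=
  fun i => Sum.elim Sum.inl ψ (φ i)

lemma fill_fillPattern (φ : ι → α ⊕ η) (ψ : η → α ⊕ κ) (u : κ → α) :
    fill (fillPattern φ ψ) u = fill φ (fill ψ u) := by
  funext i
  rcases h : φ i with a | e <;> simp [fill, fillPattern, h]

lemma IsProper.fillPattern {φ : ι → α ⊕ η} {ψ : η → α ⊕ κ} (hφ : IsProper φ)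
    (hψ : IsProper ψ) : IsProper (fillPattern φ ψ) := fun e => by
  obtain ⟨j, hj⟩ := hψ e
  obtain ⟨i, hi⟩ := hφ j
  exact ⟨i, by simp [_root_.fillPattern, hi, hj]⟩

lemma nonempty_of_density_pos {X : Type*} {E : Set X} (h : 0 < density E) : E.Nonempty := by
  rw [Set.nonempty_iff_ne_empty]
  rintro rfl
  exact h.ne' density_empty

end Words

theorem DHJ.multiDHJ {α : Type} [Finite α] [Nonempty α] (h : DHJ α) : MultiDHJ α := by
  intro m
  induction m with
  | zero =>
    refine fun δ hδ => ⟨0, fun ι _ _ A hA => ?_⟩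
    obtain ⟨w, hw⟩ := nonempty_of_density_pos (hδ.trans_le hA)
    exact ⟨fun i => Sum.inl (w i), fun e => e.elim0, fun u => hw⟩
  | succ m ih =>
    intro δ hδ
    obtain ⟨N₁, hN₁⟩ := h (δ / 2) (by positivity)
    have hcard : 0 < (Nat.card (Fin N₁ → Option α) : ℝ) := by exact_mod_cast Nat.card_pos
    obtain ⟨N₂, hN₂⟩ := ih (δ / 2 / Nat.card (Fin N₁ → Option α)) (by positivity)
    refine ⟨N₁ + N₂, fun ι _ hι A hA => ?_⟩
    obtain ⟨e⟩ := nonempty_split_equiv (show N₁ ≤ Nat.card ι by omega)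
    let W := wordEquiv α e
    rw [← density_comp_equiv W, density_prod'] at hA
    have h1 := avg_le_density_add (f := fun y => density {x | (x, y) ∈ W ⁻¹' A})
      (fun y => density_le_one _) (show 0 ≤ δ / 2 by positivity)
    obtain ⟨p, hp⟩ := exists_density_ge_of_cover (half_pos hδ)
      (E := {y | δ / 2 ≤ density {x | (x, y) ∈ W ⁻¹' A}}) (by linarith)
      (fun (p : Fin N₁ → Option α) =>
        {y | (∃ i, p i = none) ∧ ∀ a, W ((fun i => (p i).getD a), y) ∈ A})
      (fun y hy => by
        obtain ⟨p, hp1, hp2⟩ := hN₁ (Fin N₁) (by simp) _ hy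
        exact ⟨p, hp1, hp2⟩)
    obtain ⟨φ, hφ, hφA⟩ := hN₂ (Fin (Nat.card ι - N₁)) (by simp; omega) _ hp
    obtain ⟨⟨i₀, hi₀⟩, -⟩ := hφA fun _ => Classical.arbitrary α
    let ψ : Fin N₁ ⊕ Fin (Nat.card ι - N₁) → α ⊕ Fin (m + 1) :=
      Sum.elim (fun i => (p i).elim (Sum.inr 0) Sum.inl) fun i => Sum.map id Fin.succ (φ i)
    refine ⟨fun i => ψ (e.symm i), fun j => ?_, fun u => ?_⟩
    · refine Fin.cases ?_ (fun j => ?_) j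
      · exact ⟨e (Sum.inl i₀), by simp [ψ, hi₀]⟩
      · obtain ⟨i, hi⟩ := hφ j
        exact ⟨e (Sum.inr i), by simp [ψ, hi]⟩
    · have : fill (fun i => ψ (e.symm i)) u =
          W ((fun i => (p i).getD (u 0)), fill φ fun j => u j.succ) := by
        rw [eq_wordEquiv_iff]
        refine ⟨fun i => ?_, fun i => ?_⟩
        · rcases hpi : p i with _ | b <;> simp [fill, ψ, hpi]
        · rcases hpi : φ i with b | j <;> simp [fill, ψ, hpi]
      rw [this]
      exact (hφA _).2 (u 0)

section Insensitive

variable {α η κ ι : Type*}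

/-- Replacing the extra letter `none` by the letter `a`. -/
def collapse (a : α) (w : ι → Option α) : ι → Option α := fun i => some ((w i).getD a)

/-- The set `E` is not affected by exchanging the letters `none` and `some a`. -/
def Insensitive (a : α) (E : Set (ι → Option α)) : Prop := ∀ w, w ∈ E ↔ collapse a w ∈ E

lemma collapse_collapse (a : α) (w : ι → Option α) : collapse a (collapse a w) = collapse a w := rfl

lemma collapse_fill_collapse (a : α) (φ : ι → Option α ⊕ η) (u : η → Option α) :
    collapse a (fill φ (collapse a u)) = collapse a (fill φ u) := by
  funext i
  rcases h : φ i with b | e <;> simp [collapse, fill, h]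

lemma Insensitive.compl {a : α} {E : Set (ι → Option α)} (h : Insensitive a E) :
    Insensitive a Eᶜ := fun w => not_congr (h w)

lemma Insensitive.preimage_fill {a : α} {E : Set (ι → Option α)} (h : Insensitive a E)
    (φ : ι → Option α ⊕ η) : Insensitive a (fill φ ⁻¹' E) := fun u => by
  rw [Set.mem_preimage, Set.mem_preimage, h, h (fill φ (collapse a u)), collapse_fill_collapse]

lemma equidistributed_option_map [Finite α] [Nonempty α] :
    Equidistributed fun x : Option α × α => x.1.map fun _ => x.2 := fun F => by
  cases nonempty_fintype α
  have : (Fintype.card α : ℝ) ≠ 0 := by exact_mod_cast Fintype.card_ne_zero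
  rw [avg_prod]
  simp only [avg_eq_sum, Fintype.sum_option, Option.map_none, Option.map_some, sum_const,
    card_univ, nsmul_eq_mul, Fintype.card_option]
  field_simp

lemma equidistributed_pi_prod [Finite ι] {X Y Z : Type*} [Finite X] [Finite Y] [Finite Z]
    {Φ : X × Y → Z} (h : Equidistributed Φ) :
    Equidistributed fun (p : (ι → X) × (ι → Y)) i => Φ (p.1 i, p.2 i) :=
  h.pi.comp (Equidistributed.equiv (Equiv.arrowProdEquivProdArrow ι (fun _ => X) fun _ => Y).symm)

end Insensitive

lemma MultiDHJ.exists_fill_mem_of_insensitive {α : Type} [Finite α] (h : MultiDHJ α) (a : α)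
    (m : ℕ) {ε : ℝ} (hε : 0 < ε) :
    ∃ N : ℕ, ∀ (ι : Type) [Finite ι], N ≤ Nat.card ι → ∀ E : Set (ι → Option α),
      Insensitive a E → ε ≤ density E →
        ∃ φ : ι → Option α ⊕ Fin m, IsProper φ ∧ ∀ u, fill φ u ∈ E := by
  classical
  have : Nonempty α := ⟨a⟩
  obtain ⟨M, hM⟩ := h m (ε / 2) (by positivity)
  obtain ⟨N, hN⟩ := exists_density_few_le (some a) M (show 0 < ε / 4 by positivity)
  refine ⟨N, fun ι _ hι E hE hd => ?_⟩
  rw [← (equidistributed_pi_prod (ι := ι) equidistributed_option_map).density_preimage,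
    density_prod] at hd
  have h1 := avg_le_density_add (f := fun w : ι → Option α =>
      density {u : ι → α | (fun i => (w i).map fun _ => u i) ∈ E})
    (fun y => density_le_one _) (show 0 ≤ ε / 2 by positivity)
  have h2 : ¬ {w : ι → Option α | ε / 2 ≤ density {u : ι → α |
      (fun i => (w i).map fun _ => u i) ∈ E}} ⊆ {w | Nat.card {i // w i = some a} < M} :=
    fun hsub => by
      have := (density_mono hsub).trans (hN ι hι)
      have hd' : ε ≤ avg fun w : ι → Option α =>
        density {u : ι → α | (fun i => (w i).map fun _ => u i) ∈ E} := hd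
      linarith
  obtain ⟨w, hw1, hw2⟩ := Set.not_subset.1 h2
  simp only [Set.mem_ofPred_eq, not_lt] at hw1 hw2
  let J := {i // (w i).isSome}
  have hJ : M ≤ Nat.card J := hw2.trans <| Nat.card_le_card_of_injective
    (fun i : {i // w i = some a} => (⟨i.1, by simp [i.2]⟩ : J))
    fun i j hij => Subtype.ext (congrArg (fun z : J => z.1) hij)
  let ext : (J → α) → ι → Option α := fun u i =>
    if hi : (w i).isSome then some (u ⟨i, hi⟩) else none
  have hext : {u : ι → α | (fun i => (w i).map fun _ => u i) ∈ E} =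
      (fun u : ι → α => u ∘ (Subtype.val : J → ι)) ⁻¹' (ext ⁻¹' E) := by
    ext u
    have : (fun i => (w i).map fun _ => u i) = ext (u ∘ (Subtype.val : J → ι)) := by
      funext i
      rcases hwi : w i with _ | b <;> simp [ext, hwi]
    simp only [Set.mem_ofPred_eq, Set.mem_preimage, this]
  rw [hext, (Equidistributed.precomp Subtype.val_injective).density_preimage] at hw1
  obtain ⟨φ, hφ, hφE⟩ := hM J hJ _ hw1
  refine ⟨fun i => if hi : (w i).isSome then Sum.map some id (φ ⟨i, hi⟩) else Sum.inl none,
    fun j => ?_, fun u => ?_⟩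
  · obtain ⟨i, hi⟩ := hφ j
    exact ⟨i.1, by simp [i.2, hi]⟩
  · rw [hE]
    have := (hE _).1 (hφE fun j => (u j).getD a)
    convert! this using 1
    funext i
    by_cases hi : (w i).isSome
    · rcases hφi : φ ⟨i, hi⟩ with b | j <;> simp [collapse, fill, ext, hi, hφi]
    · simp [collapse, fill, ext, hi]

section InsensitiveSums

variable {α : Type} [Finite α]

/-- One step of the exhaustion argument: on words of length `N`, an insensitive set of density at
least `ε` contains a subspace, so a definite portion of an insensitive set can be removed. -/
lemma avg_indicator_le_of_exhaustion (a : α) (m N : ℕ) {ε : ℝ} (hε : 0 < ε)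
    (hN : ∀ E : Set (Fin N → Option α), Insensitive a E → ε ≤ density E →
      ∃ φ : Fin N → Option α ⊕ Fin m, IsProper φ ∧ ∀ u, fill φ u ∈ E) (t : ℕ) :
    ∀ (ι X : Type) [Finite ι] [Finite X] [Nonempty X], t * N ≤ Nat.card ι →
      ∀ (R : Set (X × (ι → Option α))) (f : X × (ι → Option α) → ℝ),
        (∀ x, Insensitive a {w | (x, w) ∈ R}) → (∀ p, f p ≤ 1) →
        (∀ x (φ : ι → Option α ⊕ Fin m), IsProper φ → avg (fun u => f (x, fill φ u)) ≤ 0) →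
        density R ≤ 2 * ε + t * (ε / Nat.card (Fin N → Option α)) →
        avg (R.indicator f) ≤ 2 * ε := by
  classical
  have trivial_bound : ∀ (Y : Type) [Finite Y] (R : Set Y) (f : Y → ℝ), (∀ p, f p ≤ 1) →
      avg (R.indicator f) ≤ density R := fun Y _ R f hf =>
    avg_mono fun p => Set.indicator_le_indicator (hf p)
  have hcard : 0 < (Nat.card (Fin N → Option α) : ℝ) := by exact_mod_cast Nat.card_pos
  induction t with
  | zero =>
    intro ι X _ _ _ _ R f _ hf _ hR
    exact (trivial_bound _ R f hf).trans (by simpa using hR)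
  | succ t ih =>
    intro ι X _ _ _ hι R f hR hf hsub hd
    rcases le_or_gt (density R) (2 * ε) with hsmall | hlarge
    · exact (trivial_bound _ R f hf).trans hsmall
    have hι' : t * N + N ≤ Nat.card ι := by rw [← Nat.succ_mul]; exact hι
    obtain ⟨e⟩ := nonempty_split_equiv (show N ≤ Nat.card ι by omega)
    set κ := Fin (Nat.card ι - N) with hκ
    let W := wordEquiv (Option α) e
    -- regroup the words as `(x, v), y` with `v` of length `N`
    let G : (X × (Fin N → Option α)) × (κ → Option α) ≃ X × (ι → Option α) :=
      (Equiv.prodAssoc _ _ _).trans (Equiv.prodCongr (Equiv.refl X) W)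
    have hG : ∀ x v y, G ((x, v), y) = (x, W (v, y)) := fun x v y => rfl
    have hW : ∀ v y, collapse a (W (v, y)) = W (collapse a v, collapse a y) := fun v y => by
      rw [eq_wordEquiv_iff]
      exact ⟨fun i => by simp [collapse, W], fun i => by simp [collapse, W]⟩
    let sec : X → (κ → Option α) → Set (Fin N → Option α) := fun x y => {v | (x, W (v, y)) ∈ R}
    have hsec_ins : ∀ x y, Insensitive a (sec x y) := fun x y v => by
      change (x, W (v, y)) ∈ R ↔ (x, W (collapse a v, y)) ∈ R
      have h1 := hR x (W (v, y))
      have h2 := hR x (W (collapse a v, y))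
      simp only [Set.mem_ofPred_eq, hW, collapse_collapse] at h1 h2
      rw [h1, h2]
    have hsec_collapse : ∀ x y, sec x (collapse a y) = sec x y := fun x y => by
      ext v
      change (x, W (v, collapse a y)) ∈ R ↔ (x, W (v, y)) ∈ R
      have h1 := hR x (W (v, y))
      have h2 := hR x (W (v, collapse a y))
      simp only [Set.mem_ofPred_eq, hW, collapse_collapse] at h1 h2
      rw [h1, h2]
    choose! Φ hΦ hΦmem using hN
    let removed : Set (Fin N → Option α) → Set (Fin N → Option α) := fun E =>
      if ε ≤ density E then Set.range (fill (Φ E)) else ∅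
    have hremoved : ∀ x y, removed (sec x y) ⊆ sec x y := fun x y => by
      simp only [removed]
      split_ifs with hE
      · rintro _ ⟨u, rfl⟩
        exact hΦmem _ (hsec_ins x y) hE u
      · exact Set.empty_subset _
    let Q : Set ((X × (Fin N → Option α)) × (κ → Option α)) :=
      {p | p.1.2 ∈ removed (sec p.1.1 p.2)}
    let R' : Set ((X × (Fin N → Option α)) × (κ → Option α)) := G ⁻¹' R \ Q
    have hQR : Q ⊆ G ⁻¹' R := fun p hp => hremoved _ _ hp
    have hsplit : ∀ g : (X × (Fin N → Option α)) × (κ → Option α) → ℝ,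
        avg ((G ⁻¹' R).indicator g) = avg (R'.indicator g) + avg (Q.indicator g) := fun g => by
      rw [← avg_add]
      congr 1
      funext p
      by_cases hp : p ∈ Q
      · simp [R', hp, hQR hp]
      · by_cases hp' : p ∈ G ⁻¹' R <;> simp [R', hp, hp']
    -- reorder `(x, v), y` as `(x, y), v`
    let S : (X × (κ → Option α)) × (Fin N → Option α) ≃
        (X × (Fin N → Option α)) × (κ → Option α) :=
      { toFun := fun p => ((p.1.1, p.2), p.1.2)
        invFun := fun p => ((p.1.1, p.2), p.1.2)
        left_inv := fun _ => rfl
        right_inv := fun _ => rfl }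
    have hQdens : ε / Nat.card (Fin N → Option α) ≤ density Q := by
      have h1 : density R = avg fun p : X × (κ → Option α) => density (sec p.1 p.2) := by
        rw [← density_comp_equiv (S.trans G) R, density_prod]
        rfl
      have h2 := avg_le_density_add (f := fun p : X × (κ → Option α) => density (sec p.1 p.2))
        (fun _ => density_le_one _) hε.le
      have h3 : density Q = avg fun p : X × (κ → Option α) => density (removed (sec p.1 p.2)) := by
        rw [← density_comp_equiv S Q, density_prod]
        rfl
      have h4 : 1 / Nat.card (Fin N → Option α) *
          density {p : X × (κ → Option α) | ε ≤ density (sec p.1 p.2)} ≤ density Q := by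
        rw [h3, density, ← avg_const_mul]
        refine avg_mono fun p => ?_
        by_cases hp : ε ≤ density (sec p.1 p.2)
        · have hmem : p ∈ {p : X × (κ → Option α) | ε ≤ density (sec p.1 p.2)} := hp
          rw [Set.indicator_of_mem hmem, mul_one, ← density_singleton (fill (Φ (sec p.1 p.2))
            fun _ => none)]
          refine density_mono ?_
          simp only [removed, if_pos hp, Set.singleton_subset_iff]
          exact ⟨_, rfl⟩
        · have hmem : p ∉ {p : X × (κ → Option α) | ε ≤ density (sec p.1 p.2)} := hp
          rw [Set.indicator_of_notMem hmem, mul_zero]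
          exact density_nonneg _
      refine le_trans ?_ h4
      rw [div_eq_mul_one_div, mul_comm]
      gcongr
      linarith
    have hdR' : density R' = density R - density Q := by
      have := hsplit fun _ => 1
      rw [← density_comp_equiv G R]
      exact (sub_eq_of_eq_add this).symm
    have hQf : avg (Q.indicator fun p => f (G p)) ≤ 0 := by
      rw [← avg_comp_equiv S, avg_prod]
      refine avg_nonpos fun p => ?_
      by_cases hp : ε ≤ density (sec p.1 p.2)
      · have hprop := hΦ _ (hsec_ins p.1 p.2) hp
        set φ := Φ (sec p.1 p.2) with hφ
        have hind : (fun v => Q.indicator (fun p => f (G p)) (S (p, v))) =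
            (Set.range (fill φ)).indicator fun v => f (p.1, W (v, p.2)) := by
          funext v
          have : S (p, v) ∈ Q ↔ v ∈ Set.range (fill φ) := by
            change v ∈ removed (sec p.1 p.2) ↔ _
            simp only [removed, if_pos hp, hφ]
          by_cases hv : v ∈ Set.range (fill φ)
          · rw [Set.indicator_of_mem (this.2 hv), Set.indicator_of_mem hv]
            rfl
          · rw [Set.indicator_of_notMem (mt this.1 hv), Set.indicator_of_notMem hv]
        rw [hind, avg]
        refine div_nonpos_of_nonpos_of_nonneg ?_ (Nat.cast_nonneg _)
        rw [← finsum_mem_def, finsum_mem_range (fill_injective hprop)]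
        let ψ : ι → Option α ⊕ Fin m :=
          fun i => Sum.elim φ (fun j => Sum.inl (p.2 j)) (e.symm i)
        have hψ : IsProper ψ := fun j => by
          obtain ⟨i, hi⟩ := hprop j
          exact ⟨e (Sum.inl i), by simp [ψ, hi]⟩
        have hfill : ∀ u, fill ψ u = W (fill φ u, p.2) := fun u => by
          rw [eq_wordEquiv_iff]
          exact ⟨fun i => by simp [fill, ψ], fun i => by simp [fill, ψ]⟩
        have := hsub p.1 ψ hψ
        simp only [hfill] at this
        rw [avg, div_le_iff₀ (by exact_mod_cast Nat.card_pos), zero_mul] at this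
        exact this
      · refine avg_nonpos fun v => ?_
        rw [Set.indicator_of_notMem]
        change ¬ v ∈ removed (sec p.1 p.2)
        simp [removed, hp]
    have hmain := ih κ (X × (Fin N → Option α)) (by simp [hκ]; omega) R' (fun p => f (G p))
      (fun p y => by
        change ((p, y) ∈ G ⁻¹' R ∧ ¬ p.2 ∈ removed (sec p.1 y)) ↔
          ((p, collapse a y) ∈ G ⁻¹' R ∧ ¬ p.2 ∈ removed (sec p.1 (collapse a y)))
        have : (p, collapse a y) ∈ G ⁻¹' R ↔ (p, y) ∈ G ⁻¹' R :=
          Set.ext_iff.1 (hsec_collapse p.1 y) p.2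
        rw [hsec_collapse, this])
      (fun p => hf _)
      (fun p φ hφ => by
        let ψ : ι → Option α ⊕ Fin m :=
          fun i => Sum.elim (fun j => Sum.inl (p.2 j)) φ (e.symm i)
        have hψ : IsProper ψ := fun j => by
          obtain ⟨i, hi⟩ := hφ j
          exact ⟨e (Sum.inr i), by simp [ψ, hi]⟩
        have hfill : ∀ u, fill ψ u = W (p.2, fill φ u) := fun u => by
          rw [eq_wordEquiv_iff]
          exact ⟨fun i => by simp [fill, ψ], fun i => by simp [fill, ψ]⟩
        have := hsub p.1 ψ hψ
        simp only [hfill] at this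
        exact this)
      (by
        rw [hdR']
        push_cast at hd
        linarith)
    have hRf : avg (R.indicator f) = avg ((G ⁻¹' R).indicator fun p => f (G p)) :=
      (avg_comp_equiv G _).symm
    rw [hRf, hsplit]
    linarith

lemma MultiDHJ.avg_indicator_le (h : MultiDHJ α) (a : α) (m : ℕ) {ε : ℝ} (hε : 0 < ε) :
    ∃ N : ℕ, ∀ (ι : Type) [Finite ι], N ≤ Nat.card ι →
      ∀ (E : Set (ι → Option α)) (f : (ι → Option α) → ℝ), Insensitive a E → (∀ w, f w ≤ 1) →
        (∀ φ : ι → Option α ⊕ Fin m, IsProper φ → avg (fun u => f (fill φ u)) ≤ 0) →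
        avg (E.indicator f) ≤ ε := by
  obtain ⟨N, hN⟩ := h.exists_fill_mem_of_insensitive a m (half_pos hε)
  have hcard : 0 < (Nat.card (Fin N → Option α) : ℝ) := by exact_mod_cast Nat.card_pos
  obtain ⟨t, ht⟩ := exists_nat_ge (1 / (ε / 2 / Nat.card (Fin N → Option α)))
  rw [div_le_iff₀ (by positivity)] at ht
  refine ⟨t * N, fun ι _ hι E f hE hf hsub => ?_⟩
  have := avg_indicator_le_of_exhaustion a m N (half_pos hε) (hN (Fin N) (by simp)) t ι Unit hι
    (Prod.snd ⁻¹' E) (fun p => f p.2) (fun _ => hE) (fun p => hf p.2) (fun _ => hsub)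
    ((density_le_one _).trans (by linarith))
  rw [avg_prod] at this
  have h2 : (avg fun _ : Unit => avg (E.indicator f)) ≤ 2 * (ε / 2) := this
  rw [avg_const] at h2
  linarith

lemma MultiDHJ.avg_indicator_union_le (h : MultiDHJ α) (s : Finset α) :
    ∀ (m : ℕ) (ε : ℝ), 0 < ε → ∃ N : ℕ, ∀ (ι : Type) [Finite ι], N ≤ Nat.card ι →
      ∀ (E : α → Set (ι → Option α)) (f : (ι → Option α) → ℝ),
        (∀ a, Insensitive a (E a)) → (∀ w, f w ≤ 1) →
        (∀ φ : ι → Option α ⊕ Fin m, IsProper φ → avg (fun u => f (fill φ u)) ≤ 0) →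
        avg ({w | ∃ a ∈ s, w ∈ E a}.indicator f) ≤ ε := by
  classical
  induction s using Finset.induction_on with
  | empty =>
    refine fun m ε hε => ⟨0, fun ι _ _ E f _ _ _ => ?_⟩
    simpa [avg] using hε.le
  | insert a s _ ih =>
    intro m ε hε
    obtain ⟨m₁, hm₁⟩ := ih m (ε / 4) (by positivity)
    obtain ⟨N₁, hN₁⟩ := h.avg_indicator_le a m (show 0 < ε / 2 by positivity)
    obtain ⟨N₂, hN₂⟩ := h.avg_indicator_le a m₁ (show 0 < ε / 4 by positivity)
    refine ⟨max N₁ N₂, fun ι _ hι E f hE hf hsub => ?_⟩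
    let U : Set (ι → Option α) := {w | ∃ b ∈ s, w ∈ E b}
    have h1 := hN₁ ι (le_of_max_le_left hι) (E a) f (hE a) hf hsub
    have h2 := hN₂ ι (le_of_max_le_right hι) (E a)ᶜ (fun w => U.indicator f w - ε / 4) (hE a).compl
      (fun w => by
        have : U.indicator f w ≤ 1 := Set.indicator_apply_le' (fun _ => hf w) fun _ => zero_le_one
        linarith)
      (fun φ hφ => by
        have := hm₁ (Fin m₁) (by simp) (fun b => fill φ ⁻¹' E b) (fun u => f (fill φ u))
          (fun b => (hE b).preimage_fill φ) (fun u => hf _) (fun ψ hψ => by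
            have := hsub _ (hφ.fillPattern hψ)
            simpa only [fill_fillPattern] using this)
        rw [avg_sub, avg_const]
        exact sub_nonpos.2 this)
    have h3 : avg ({w | ∃ b ∈ insert a s, w ∈ E b}.indicator f) ≤
        avg ((E a).indicator f) +
          (avg ((E a)ᶜ.indicator fun w => U.indicator f w - ε / 4) + ε / 4) := by
      rw [← avg_const (X := ι → Option α) (ε / 4), ← avg_add, ← avg_add, avg_const]
      refine avg_mono fun w => ?_
      have hmem : w ∈ {w | ∃ b ∈ insert a s, w ∈ E b} ↔ w ∈ E a ∨ w ∈ U := by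
        simp [U]
      by_cases hwa : w ∈ E a
      · rw [Set.indicator_of_mem (hmem.2 (Or.inl hwa)), Set.indicator_of_mem hwa,
          Set.indicator_of_notMem (by simpa using hwa)]
        linarith
      · rw [Set.indicator_of_notMem hwa, Set.indicator_of_mem (Set.mem_compl hwa)]
        by_cases hwU : w ∈ U
        · rw [Set.indicator_of_mem (hmem.2 (Or.inr hwU)), Set.indicator_of_mem hwU]
          linarith
        · rw [Set.indicator_of_notMem (by tauto), Set.indicator_of_notMem hwU]
          linarith
    linarith

end InsensitiveSums

lemma HasLine.of_preimage_fill {α η ι : Type*} {φ : ι → α ⊕ η} (hφ : IsProper φ) {A : Set (ι → α)}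
    (h : HasLine (fill φ ⁻¹' A)) : HasLine A := by
  obtain ⟨p, ⟨j, hj⟩, hp⟩ := h
  refine ⟨fun i => Sum.elim some p (φ i), ?_, fun a => ?_⟩
  · obtain ⟨i, hi⟩ := hφ j
    exact ⟨i, by simp [hi, hj]⟩
  · have : (fun i => (Sum.elim some p (φ i)).getD a) = fill φ fun j => (p j).getD a := by
      funext i
      rcases h : φ i with b | j <;> simp [fill, h]
    rw [this]
    exact hp a

section Increment

variable {α : Type} {ι κ η ν J : Type}

lemma hasLine_of_collapse_mem (e : κ ⊕ ν ≃ ι) {A : Set (ι → Option α)} {w : κ → Option α}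
    {y : ν → Option α} {i : κ} (hi : w i = none) (hw : wordEquiv _ e (w, y) ∈ A)
    (hcol : ∀ a, wordEquiv _ e (collapse a w, y) ∈ A) : HasLine A := by
  refine ⟨wordEquiv _ e (fun i => (w i).map some, fun i => some (y i)),
    ⟨e (Sum.inl i), by simp [hi]⟩, fun o => ?_⟩
  cases o with
  | none =>
    convert hw using 1
    rw [eq_wordEquiv_iff]
    refine ⟨fun i => ?_, fun i => ?_⟩
    · rcases h : w i with _ | b <;> simp [h]
    · simp
  | some a =>
    convert hcol a using 1
    rw [eq_wordEquiv_iff]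
    refine ⟨fun i => ?_, fun i => ?_⟩
    · rcases h : w i with _ | b <;> simp [collapse, h]
    · simp

/-- On a subspace of large dimension, a line-free set avoids the points all of whose collapses
belong to it, and is not too dense on the complement of these points. -/
lemma density_le_of_not_hasLine [Finite α] [Finite J] (e : κ ⊕ ν ≃ ι) {A : Set (ι → Option α)}
    (hA : ¬ HasLine A) (y : ν → Option α) {χ : κ → Option α ⊕ J} (hχ : IsProper χ) {δ ε : ℝ}
    {m : ℕ} (hδ : 0 ≤ δ) (hε : 0 ≤ ε)
    (hupper : ∀ B : Set (Fin m → Option α), ¬ HasLine B → density B ≤ δ + ε)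
    (hunion : ∀ (E : α → Set (J → Option α)) (f : (J → Option α) → ℝ),
      (∀ a, Insensitive a (E a)) → (∀ w, f w ≤ 1) →
      (∀ φ : J → Option α ⊕ Fin m, IsProper φ → avg (fun u => f (fill φ u)) ≤ 0) →
      avg ({w | ∃ a, w ∈ E a}.indicator f) ≤ ε)
    (hfew : density {v : J → Option α | Nat.card {i // v i = none} < 1} ≤ ε) :
    density {v | wordEquiv _ e (fill χ v, y) ∈ A} ≤
      (δ + ε) * (1 - density {v | ∀ a, wordEquiv _ e (collapse a (fill χ v), y) ∈ A}) + 2 * ε := by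
  classical
  let P : Set (J → Option α) := {v | wordEquiv _ e (fill χ v, y) ∈ A}
  let D : Set (J → Option α) := {v | ∀ a, wordEquiv _ e (collapse a (fill χ v), y) ∈ A}
  let E : α → Set (J → Option α) := fun a => {v | wordEquiv _ e (collapse a (fill χ v), y) ∉ A}
  let f : (J → Option α) → ℝ := fun v => P.indicator (fun _ => 1) v - (δ + ε)
  let Z : Set (J → Option α) := {v | Nat.card {i // v i = none} < 1}
  have hE : ∀ a, Insensitive a (E a) := fun a v => by
    change wordEquiv _ e (collapse a (fill χ v), y) ∉ A ↔
      wordEquiv _ e (collapse a (fill χ (collapse a v)), y) ∉ A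
    rw [collapse_fill_collapse]
  have hf : ∀ v, f v ≤ 1 := fun v => by
    have : P.indicator (fun _ => (1 : ℝ)) v ≤ 1 :=
      Set.indicator_apply_le' (fun _ => le_rfl) fun _ => zero_le_one
    simp only [f]
    linarith
  let Θ : ι → Option α ⊕ J := fun i => Sum.elim χ (fun j => Sum.inl (y j)) (e.symm i)
  have hΘ : IsProper Θ := fun j => by
    obtain ⟨i, hi⟩ := hχ j
    exact ⟨e (Sum.inl i), by simp [Θ, hi]⟩
  have hfill : ∀ v, fill Θ v = wordEquiv _ e (fill χ v, y) := fun v => by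
    rw [eq_wordEquiv_iff]
    exact ⟨fun i => by simp [fill, Θ], fun i => by simp [fill, Θ]⟩
  have h1 := hunion E f hE hf fun φ hφ => by
    have hline : ¬ HasLine (fill φ ⁻¹' P) := fun hl => by
      refine hA (HasLine.of_preimage_fill (hΘ.fillPattern hφ) ?_)
      convert hl using 1
      ext u
      simp only [Set.mem_preimage, fill_fillPattern, hfill]
      rfl
    have hden := hupper _ hline
    simp only [f]
    rw [avg_sub, avg_const]
    exact sub_nonpos.2 hden
  have hpt : ∀ v, P.indicator (fun _ => (1 : ℝ)) v ≤ {w | ∃ a, w ∈ E a}.indicator f v +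
      ((δ + ε) * (1 - D.indicator (fun _ => 1) v) + Z.indicator (fun _ => 1) v) := fun v => by
    have hZ : 0 ≤ Z.indicator (fun _ => (1 : ℝ)) v :=
      Set.indicator_nonneg (fun _ _ => zero_le_one) _
    by_cases hD : v ∈ D
    · have hU : v ∉ {w | ∃ a, w ∈ E a} := fun ⟨a, ha⟩ => ha (hD a)
      rw [Set.indicator_of_notMem hU, Set.indicator_of_mem hD]
      by_cases hP : v ∈ P
      · have hvZ : v ∈ Z := by
          change Nat.card {i // v i = none} < 1
          rw [Nat.lt_one_iff, Finite.card_eq_zero_iff]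
          refine ⟨fun i => hA ?_⟩
          obtain ⟨k, hk⟩ := hχ i.1
          exact hasLine_of_collapse_mem e (i := k) (by simp [fill, hk, i.2]) hP hD
        rw [Set.indicator_of_mem hP, Set.indicator_of_mem hvZ]
        linarith
      · rw [Set.indicator_of_notMem hP]
        linarith
    · have hU : v ∈ {w | ∃ a, w ∈ E a} := by
        by_contra hU
        exact hD fun a => by
          by_contra ha
          exact hU ⟨a, ha⟩
      rw [Set.indicator_of_mem hU, Set.indicator_of_notMem hD]
      simp only [f]
      linarith
  have h2 := avg_mono hpt
  rw [avg_add, avg_add, avg_const_mul, avg_sub, avg_const] at h2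
  change density P ≤ (δ + ε) * (1 - density D) + 2 * ε
  change density P ≤ _ + ((δ + ε) * (1 - density D) + density Z) at h2
  change density Z ≤ ε at hfew
  linarith

/-- If a function is bounded by `c` and its average is near `c`, all its values are near `c`. -/
lemma le_apply_of_forall_le {X : Type*} [Finite X] {f : X → ℝ} {c : ℝ} (hf : ∀ x, f x ≤ c) (x : X) :
    c - Nat.card X * (c - avg f) ≤ f x := by
  cases nonempty_fintype X
  have hX : (Fintype.card X : ℝ) ≠ 0 := by
    have : Nonempty X := ⟨x⟩
    exact_mod_cast Fintype.card_ne_zero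
  have h := single_le_sum (f := fun x => c - f x) (fun i _ => sub_nonneg.2 (hf i)) (mem_univ x)
  rw [sum_sub_distrib, sum_const, card_univ, nsmul_eq_mul] at h
  rw [avg_eq_sum, Nat.card_eq_fintype_card, mul_sub, mul_div_cancel₀ _ hX]
  linarith

/-- Resampling the letters of `α` and the distinguished wildcard `k`. -/
noncomputable def resample (k : κ) (x : (α ⊕ κ) × Option α) : α ⊕ κ :=
  open Classical in
  if ∀ j, x.1 = Sum.inr j → j = k then x.2.elim (Sum.inr k) Sum.inl else x.1

lemma equidistributed_resample [Finite α] [Finite κ] (k : κ) :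
    Equidistributed (resample (α := α) k) := fun F => by
  classical
  cases nonempty_fintype α
  cases nonempty_fintype κ
  rw [avg_prod]
  simp only [avg_eq_sum, Fintype.sum_sum_type, resample, Fintype.card_option, Fintype.card_sum]
  have h1 : ∀ j : κ, (∑ t : Option α, F (if ∀ j', (Sum.inr j : α ⊕ κ) = Sum.inr j' → j' = k
      then t.elim (Sum.inr k) Sum.inl else Sum.inr j)) =
      (if j = k then ∑ a, F (Sum.inl a) - Fintype.card α * F (Sum.inr k) else 0) +
        (Fintype.card α + 1) * F (Sum.inr j) := fun j => by
    by_cases hj : j = k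
    · subst hj
      simp
      ring
    · simp [hj]
  have h2 : (∑ j : κ, (if j = k then ∑ a, F (Sum.inl a) - Fintype.card α * F (Sum.inr k) else 0)) =
      ∑ a, F (Sum.inl a) - Fintype.card α * F (Sum.inr k) := by simp
  simp only [h1, ← sum_div, sum_add_distrib, h2, ← mul_sum]
  have : (Fintype.card α + Fintype.card κ : ℝ) ≠ 0 := by
    have : Nonempty κ := ⟨k⟩
    have := Fintype.card_pos (α := κ)
    positivity
  simp
  field_simp
  ring

end Increment

/-- Substituting a word for the wildcards of a word over `α ⊕ κ`. -/
def substitute {α β κ Λ : Type*} (g : α → β) (p : κ → β) (ψ : Λ → α ⊕ κ) : Λ → β :=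
  fun i => Sum.elim g p (ψ i)

lemma collapse_substitute {α κ Λ : Type*} (a : α) (p : κ → Option α) (ψ : Λ → α ⊕ κ) :
    collapse a (substitute some p ψ) = substitute some (collapse a p) ψ := by
  funext i
  rcases h : ψ i with b | k <;> simp [collapse, substitute, h]

/-- If the `α`-words of the alphabet `Option α` satisfy the density Hales-Jewett theorem and
line-free sets have density at most about `δ`, then they have density less than `δ` by a definite
amount. -/
lemma DHJ.density_increment {α : Type} [Finite α] [Nonempty α] (h : DHJ α) {δ : ℝ} (hδ : 0 < δ)
    (hupper : ∀ γ : ℝ, 0 < γ → ∃ N : ℕ, ∀ (ι : Type) [Finite ι], N ≤ Nat.card ι →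
      ∀ A : Set (ι → Option α), ¬ HasLine A → density A ≤ δ + γ) :
    ∃ γ : ℝ, 0 < γ ∧ ∃ N : ℕ, ∀ (ι : Type) [Finite ι], N ≤ Nat.card ι →
      ∀ A : Set (ι → Option α), ¬ HasLine A → density A ≤ δ - γ := by
  classical
  cases nonempty_fintype α
  obtain ⟨a₀⟩ := ‹Nonempty α›
  have : Nonempty α := ⟨a₀⟩
  obtain ⟨l, hl⟩ := h (δ / 4) (by positivity)
  have hcardp : 0 < (Nat.card (Fin l → Option α) : ℝ) := by exact_mod_cast Nat.card_pos
  set θ : ℝ := δ / 4 / Nat.card (Fin l → Option α) with hθ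
  have hθ0 : 0 < θ := by positivity
  set ε : ℝ := min (δ * θ / 6) (δ / 2) with hε
  have hε0 : 0 < ε := lt_min (by positivity) (by positivity)
  have hε1 : ε ≤ δ * θ / 6 := min_le_left _ _
  have hε2 : ε ≤ δ / 2 := min_le_right _ _
  obtain ⟨m, hm⟩ := hupper ε hε0
  obtain ⟨M₁, hM₁⟩ := h.multiDHJ.avg_indicator_union_le univ m ε hε0
  obtain ⟨M₂, hM₂⟩ := exists_density_few_le (none : Option α) 1 hε0
  obtain ⟨L, hL⟩ := exists_density_few_le (Sum.inl a₀ : α ⊕ Fin l) (max M₁ M₂) hε0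
  have hcardL : 0 < (Nat.card (Fin L → Option α) : ℝ) := by exact_mod_cast Nat.card_pos
  set γ : ℝ := ε / (2 * Nat.card (Fin L → Option α)) with hγ
  have hγ0 : 0 < γ := by positivity
  obtain ⟨N, hN⟩ := hupper γ hγ0
  refine ⟨γ, hγ0, L + N, fun ι _ hι A hA => ?_⟩
  by_contra! hdens
  obtain ⟨e⟩ := nonempty_split_equiv (show L ≤ Nat.card ι by omega)
  set ν := Fin (Nat.card ι - L) with hν
  let W := wordEquiv (Option α) e
  let S := α ⊕ Fin l
  -- every section of `A` has density close to `δ`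
  have hsection : ∀ x, δ - ε ≤ density {y | W (x, y) ∈ A} := fun x => by
    have hup : ∀ x, density {y | W (x, y) ∈ A} ≤ δ + γ := fun x => by
      refine hN ν (by simp [hν]; omega) _ fun hline => hA ?_
      let φ : ι → Option α ⊕ ν := fun i => Sum.elim (fun j => Sum.inl (x j)) Sum.inr (e.symm i)
      have hφ : IsProper φ := fun j => ⟨e (Sum.inr j), by simp [φ]⟩
      refine HasLine.of_preimage_fill hφ ?_
      convert hline using 1
      ext y
      have : fill φ y = W (x, y) := by
        rw [eq_wordEquiv_iff]
        exact ⟨fun i => by simp [fill, φ], fun i => by simp [fill, φ]⟩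
      rw [Set.mem_preimage, this]
      rfl
    have h1 := le_apply_of_forall_le hup x
    rw [← density_comp_equiv W, density_prod] at hdens
    change δ - γ < avg (fun x => density {y | W (x, y) ∈ A}) at hdens
    have h2 : Nat.card (Fin L → Option α) * (2 * γ) = ε := by
      rw [hγ]; field_simp
    have h3 : (Nat.card (Fin L → Option α) : ℝ) *
        (δ + γ - avg fun x => density {y | W (x, y) ∈ A}) ≤
          Nat.card (Fin L → Option α) * (2 * γ) := by
      gcongr
      linarith
    linarith
  -- a fixed line pattern `p` of length `l` is collapsed into `A` by many substitutions
  let g : (Fin L → S) × (ν → Option α) → ℝ := fun q =>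
    density {u : Fin l → α | W (substitute some (fun i => some (u i)) q.1, q.2) ∈ A}
  have hg : δ / 2 ≤ avg g := by
    rw [avg_prod]
    refine le_avg_of_le fun ψ => ?_
    have : (avg fun y => g (ψ, y)) = avg fun u : Fin l → α =>
        density {y | W (substitute some (fun i => some (u i)) ψ, y) ∈ A} :=
      avg_comm fun y (u : Fin l → α) =>
        A.indicator (fun _ => (1 : ℝ)) (W (substitute some (fun i => some (u i)) ψ, y))
    rw [this]
    exact le_avg_of_le fun u => by linarith [hsection (substitute some (fun i => some (u i)) ψ)]
  have hg2 := avg_le_density_add (f := g) (fun _ => density_le_one _)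
    (show 0 ≤ δ / 4 by positivity)
  obtain ⟨p, hp⟩ := exists_density_ge_of_cover (show 0 < δ / 4 by positivity)
    (E := {q | δ / 4 ≤ g q}) (by linarith)
    (fun (p : Fin l → Option α) => {q : (Fin L → S) × (ν → Option α) |
      (∃ i, p i = none) ∧ ∀ a, W (collapse a (substitute some p q.1), q.2) ∈ A})
    (fun q hq => by
      obtain ⟨p, hp1, hp2⟩ := hl (Fin l) (by simp) _ hq
      refine ⟨p, hp1, fun a => ?_⟩
      rw [collapse_substitute]
      exact hp2 a)
  obtain ⟨-, ⟨k, hk⟩, -⟩ := nonempty_of_density_pos (hθ0.trans_le hp)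
  let R : (Fin L → S) × (Fin L → Option α) → Fin L → S := fun r i => resample k (r.1 i, r.2 i)
  have hR : Equidistributed R := equidistributed_pi_prod (equidistributed_resample k)
  have hresample : ∀ C : Set ((Fin L → Option α) × (ν → Option α)),
      density {q : (Fin L → S) × (ν → Option α) | (substitute some p q.1, q.2) ∈ C} =
        avg fun q : (Fin L → S) × (ν → Option α) =>
          density {t | (substitute some p (R (q.1, t)), q.2) ∈ C} := fun C => by
    have h1 := hR fun ψ => density {y | (substitute some p ψ, y) ∈ C}
    rw [density_prod, avg_prod]
    refine h1.symm.trans ?_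
    rw [avg_prod]
    congr 1
    funext ψ
    exact avg_comm fun (t : Fin L → Option α) (y : ν → Option α) =>
      C.indicator (fun _ => (1 : ℝ)) (substitute some p (R (ψ, t)), y)
  let F : Set (Fin L → S) := {ψ | Nat.card {i // ψ i = Sum.inl a₀} < max M₁ M₂}
  let dA : (Fin L → S) × (ν → Option α) → ℝ := fun q =>
    density {t | W (substitute some p (R (q.1, t)), q.2) ∈ A}
  let dD : (Fin L → S) × (ν → Option α) → ℝ := fun q =>
    density {t | ∀ a, W (collapse a (substitute some p (R (q.1, t))), q.2) ∈ A}
  have hlocal : ∀ q, dA q ≤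
      (δ + ε) * (1 - dD q) + (F.indicator (fun _ => 1) q.1 + 2 * ε) := fun ⟨ψ, y⟩ => by
    by_cases hψ : ψ ∈ F
    · rw [Set.indicator_of_mem (by exact hψ)]
      have h1 : dA (ψ, y) ≤ 1 := density_le_one _
      have h2 : dD (ψ, y) ≤ 1 := density_le_one _
      nlinarith
    · rw [Set.indicator_of_notMem (by exact hψ), zero_add]
      let J := {i // ∀ j, ψ i = Sum.inr j → j = k}
      have hJ : max M₁ M₂ ≤ Nat.card J := (not_lt.1 hψ).trans <| Nat.card_le_card_of_injective
        (fun i : {i // ψ i = Sum.inl a₀} => (⟨i.1, by simp [i.2]⟩ : J))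
        fun i j hij => Subtype.ext (congrArg (fun z : J => z.1) hij)
      let χ : Fin L → Option α ⊕ J := fun i =>
        if hi : ∀ j, ψ i = Sum.inr j → j = k then Sum.inr ⟨i, hi⟩
        else Sum.inl (Sum.elim some p (ψ i))
      have hχ : IsProper χ := fun j => ⟨j.1, dif_pos j.2⟩
      have hsub : ∀ t, substitute some p (R (ψ, t)) = fill χ (t ∘ (Subtype.val : J → Fin L)) :=
        fun t => by
          funext i
          by_cases hi : ∀ j, ψ i = Sum.inr j → j = k
          · rcases ht : t i with _ | a <;>
              simp only [substitute, R, resample, if_pos hi, fill, χ, dif_pos hi, ht] <;>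
              simp [ht, hk]
          · simp [substitute, R, resample, fill, χ, hi]
      have hpre := Equidistributed.precomp (X := Option α) (Subtype.val_injective :
        Function.Injective (Subtype.val : J → Fin L))
      have h1 : dA (ψ, y) = density {v | W (fill χ v, y) ∈ A} := by
        rw [← hpre.density_preimage]
        simp only [dA, hsub]
        rfl
      have h2 : dD (ψ, y) = density {v | ∀ a, W (collapse a (fill χ v), y) ∈ A} := by
        rw [← hpre.density_preimage]
        simp only [dD, hsub]
        rfl
      rw [h1, h2]
      refine density_le_of_not_hasLine e hA y hχ hδ.le hε0.le (hm (Fin m) (by simp)) ?_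
        (hM₂ J (le_of_max_le_right hJ))
      intro E f hE hf hsubsp
      have := hM₁ J (le_of_max_le_left hJ) E f hE hf hsubsp
      simpa using this
  have havg := avg_mono hlocal
  rw [avg_add, avg_add, avg_const_mul, avg_sub, avg_const, avg_const] at havg
  have hF : (avg fun q : (Fin L → S) × (ν → Option α) => F.indicator (fun _ => (1 : ℝ)) q.1) ≤
      ε := by
    rw [avg_prod]
    simp only [avg_const]
    exact hL (Fin L) (by simp)
  have hdA : δ - ε ≤ avg dA := by
    have h1 := hresample (W ⁻¹' A)
    have h2 : density {q : (Fin L → S) × (ν → Option α) |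
        (substitute some p q.1, q.2) ∈ W ⁻¹' A} = avg dA := h1
    rw [← h2, density_prod]
    exact le_avg_of_le fun ψ => hsection (substitute some p ψ)
  have hdD : θ ≤ avg dD := by
    have h1 := hresample {r | ∀ a, W (collapse a r.1, r.2) ∈ A}
    have h2 : density {q : (Fin L → S) × (ν → Option α) |
        ∀ a, W (collapse a (substitute some p q.1), q.2) ∈ A} = avg dD := h1
    rw [← h2]
    exact hp.trans (density_mono fun q hq => hq.2)
  nlinarith [mul_le_mul_of_nonneg_left hdD (show 0 ≤ δ + ε by positivity), mul_pos hε0 hθ0,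
    mul_pos hδ hθ0]

theorem DHJ.option {α : Type} [Finite α] [Nonempty α] (h : DHJ α) : DHJ (Option α) := by
  let G : Set ℝ := {δ | 0 ≤ δ ∧ ∃ N : ℕ, ∀ (ι : Type) [Finite ι], N ≤ Nat.card ι →
    ∀ A : Set (ι → Option α), ¬ HasLine A → density A ≤ δ}
  have hG1 : (1 : ℝ) ∈ G := ⟨zero_le_one, 0, fun ι _ _ A _ => density_le_one A⟩
  have hbdd : BddBelow G := ⟨0, fun δ hδ => hδ.1⟩
  have hupper : ∀ γ : ℝ, 0 < γ → ∃ N : ℕ, ∀ (ι : Type) [Finite ι], N ≤ Nat.card ι →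
      ∀ A : Set (ι → Option α), ¬ HasLine A → density A ≤ sInf G + γ := fun γ hγ => by
    obtain ⟨δ, ⟨-, N, hN⟩, hlt⟩ := exists_lt_of_csInf_lt ⟨1, hG1⟩ (lt_add_of_pos_right (sInf G) hγ)
    exact ⟨N, fun ι _ hι A hA => (hN ι hι A hA).trans hlt.le⟩
  have hzero : sInf G = 0 := by
    refine le_antisymm ?_ (le_csInf ⟨1, hG1⟩ fun δ hδ => hδ.1)
    by_contra! hpos
    obtain ⟨γ, hγ, N, hN⟩ := h.density_increment hpos hupper
    have hmem : max (sInf G - γ) 0 ∈ G :=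
      ⟨le_max_right _ _, N, fun ι _ hι A hA => (hN ι hι A hA).trans (le_max_left _ _)⟩
    have := csInf_le hbdd hmem
    rcases le_max_iff.1 this with h1 | h1 <;> linarith
  intro δ hδ
  obtain ⟨N, hN⟩ := hupper (δ / 2) (by positivity)
  refine ⟨N, fun ι _ hι A hA => ?_⟩
  by_contra hline
  have := hN ι hι A hline
  linarith

lemma DHJ.of_equiv {α β : Type} (e : α ≃ β) (h : DHJ α) : DHJ β := by
  intro δ hδ
  obtain ⟨N, hN⟩ := h δ hδ
  refine ⟨N, fun ι _ hι A hA => ?_⟩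
  let E : (ι → α) ≃ (ι → β) := Equiv.arrowCongr (Equiv.refl ι) e
  rw [← density_comp_equiv E] at hA
  obtain ⟨p, ⟨i, hi⟩, hp⟩ := hN ι hι _ hA
  refine ⟨fun i => (p i).map e, ⟨i, by simp [hi]⟩, fun b => ?_⟩
  have hmem : E (fun i => (p i).getD (e.symm b)) ∈ A := hp (e.symm b)
  convert hmem using 1
  funext i
  rcases hpi : p i with _ | c <;> simp [E, Equiv.arrowCongr, hpi]

lemma dhj_of_unique (α : Type) [Unique α] : DHJ α := by
  refine fun δ hδ => ⟨1, fun ι _ hι A hA => ?_⟩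
  obtain ⟨w, hw⟩ := nonempty_of_density_pos (hδ.trans_le hA)
  have : Nonempty ι := (Nat.card_pos_iff.1 hι).1
  refine ⟨fun _ => none, ⟨Classical.arbitrary ι, rfl⟩, fun a => ?_⟩
  convert hw
  exact Subsingleton.elim _ _

/-- The density Hales-Jewett theorem. -/
theorem density_hales_jewett (k : ℕ) : DHJ (Fin (k + 1)) := by
  induction k with
  | zero => exact dhj_of_unique (Fin 1)
  | succ k ih => exact ih.option.of_equiv (finSuccEquiv (k + 1)).symm

/-- Szemerédi's theorem. -/
theorem exists_arithmetic_progression (k : ℕ) {δ : ℝ} (hδ : 0 < δ) :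
    ∃ N₀ : ℕ, ∀ N : ℕ, N₀ ≤ N → ∀ B ⊆ Finset.range N, δ * N ≤ #B →
      ∃ b d : ℕ, 0 < d ∧ ∀ j ≤ k, b + j * d ∈ B := by
  classical
  obtain ⟨m, hm⟩ := density_hales_jewett k (δ / 2) (by positivity)
  refine ⟨k * m + 1, fun N hN B hBN hB => ?_⟩
  let E : Fin (N + k * m) → Set (Fin m → Fin (k + 1)) := fun s =>
    {w | ∃ b ∈ B, (s : ℕ) + ∑ i, (w i : ℕ) = b + k * m}
  have : NeZero (N + k * m) := ⟨by omega⟩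
  have hE : δ / 2 ≤ avg fun s => density (E s) := by
    have hcomm : (avg fun s => density (E s)) = avg fun w => density {s | w ∈ E s} :=
      avg_comm fun s w => (E s).indicator (fun _ => (1 : ℝ)) w
    rw [hcomm]
    refine le_avg_of_le fun w => ?_
    have hw : ∑ i, (w i : ℕ) ≤ k * m := by
      calc ∑ i, (w i : ℕ) ≤ ∑ _i : Fin m, k := sum_le_sum fun i _ => by omega
        _ = k * m := by simp [mul_comm]
    have hcard : #B ≤ #{s | w ∈ E s} := by
      refine card_le_card_of_injOn (fun b => Fin.ofNat _ (b + k * m - ∑ i, (w i : ℕ))) ?_ ?_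
      · intro b hb
        have := Finset.mem_range.1 (hBN hb)
        simp only [coe_filter, Finset.mem_univ, true_and, E]
        refine ⟨b, hb, ?_⟩
        rw [Fin.val_ofNat, Nat.mod_eq_of_lt (by omega)]
        omega
      · intro b hb c hc hbc
        have h1 := Finset.mem_range.1 (hBN hb)
        have h2 := Finset.mem_range.1 (hBN hc)
        have := congrArg Fin.val hbc
        simp only [Fin.val_ofNat] at this
        rw [Nat.mod_eq_of_lt (by omega), Nat.mod_eq_of_lt (by omega)] at this
        omega
    have hdens : density {s | w ∈ E s} = #{s | w ∈ E s} / ((N + k * m : ℕ) : ℝ) := by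
      rw [density, avg_eq_sum]
      simp [Set.indicator_apply, natCast_card_filter]
    rw [hdens, le_div_iff₀ (by exact_mod_cast Nat.pos_of_ne_zero (NeZero.ne _))]
    have h1 : ((N + k * m : ℕ) : ℝ) ≤ 2 * N := by exact_mod_cast (by omega : N + k * m ≤ 2 * N)
    calc δ / 2 * ((N + k * m : ℕ) : ℝ) ≤ δ / 2 * (2 * N) := by gcongr
      _ = δ * N := by ring
      _ ≤ #B := hB
      _ ≤ _ := by exact_mod_cast hcard
  obtain ⟨s, hs⟩ := exists_le_of_le_avg hE
  obtain ⟨p, ⟨i₀, hi₀⟩, hp⟩ := hm (Fin m) (by simp) (E s) hs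
  choose b hb hbs using hp
  set c := ∑ i, (p i).elim 0 fun a : Fin (k + 1) => (a : ℕ)
  set d := #{i | p i = none}
  have hsum : ∀ a : Fin (k + 1), ∑ i, (((p i).getD a : Fin (k + 1)) : ℕ) = c + a * d := fun a => by
    simp only [c, d, card_filter, mul_sum, ← sum_add_distrib]
    refine sum_congr rfl fun i _ => ?_
    rcases h : p i with _ | x <;> simp
  refine ⟨b 0, d, card_pos.2 ⟨i₀, by simp [hi₀]⟩, fun j hj => ?_⟩
  have h0 := hbs 0
  have h1 := hbs ⟨j, by omega⟩
  rw [hsum] at h0 h1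
  simp only [Fin.val_zero, zero_mul] at h0
  change _ + (c + j * d) = _ at h1
  have : b 0 + j * d = b ⟨j, by omega⟩ := by omega
  rw [this]
  exact hb _

/-- Some dilate of a finite set of positive reals avoids a neighbourhood of the integers. -/
lemma exists_dilate_far_from_int (Z : Finset ℝ) (hZ : ∀ z ∈ Z, 0 < z) {ε : ℝ} (hε : 0 < ε)
    (hε1 : ε ≤ 1) (hcard : 2 * ε * #Z < 1) :
    ∃ θ : ℝ, ∀ z ∈ Z, ∀ j : ℤ, ε ≤ |θ * z - j| := by
  obtain ⟨T, hT⟩ : ∃ T : ℝ, 0 < T ∧ ∑ z ∈ Z, 4 * ε / z < (1 - 2 * ε * #Z) * T := by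
    have h0 : 0 ≤ ∑ z ∈ Z, 4 * ε / z :=
      sum_nonneg fun z hz => div_nonneg (by positivity) (hZ z hz).le
    have h1 : 0 < 1 - 2 * ε * #Z := by linarith
    refine ⟨(∑ z ∈ Z, 4 * ε / z + 1) / (1 - 2 * ε * #Z), by positivity, ?_⟩
    rw [mul_div_cancel₀ _ h1.ne']
    linarith
  obtain ⟨hT0, hT⟩ := hT
  by_contra! hbad
  have hcover : Set.Icc 0 T ⊆ ⋃ z ∈ Z, ⋃ j ∈ Finset.range (⌊T * z⌋₊ + 2),
      Set.Icc ((j - ε) / z) ((j + ε) / z) := fun θ hθ => by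
    obtain ⟨z, hz, j, hj⟩ := hbad θ
    have hz0 := hZ z hz
    rw [abs_lt] at hj
    have h1 : 0 ≤ θ * z := mul_nonneg hθ.1 hz0.le
    have h2 : θ * z ≤ T * z := mul_le_mul_of_nonneg_right hθ.2 hz0.le
    have hj0 : 0 ≤ j := by
      have : (-1 : ℝ) < j := by linarith
      have : -1 < j := by exact_mod_cast this
      omega
    lift j to ℕ using hj0
    simp only [Int.cast_natCast] at hj
    have hjT : j < ⌊T * z⌋₊ + 2 := by
      have := Nat.lt_floor_add_one (T * z)
      have : (j : ℝ) < ⌊T * z⌋₊ + 2 := by linarith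
      exact_mod_cast this
    simp only [Set.mem_iUnion]
    refine ⟨z, hz, j, Finset.mem_range.2 hjT, ?_, ?_⟩
    · rw [div_le_iff₀ hz0]
      linarith
    · rw [le_div_iff₀ hz0]
      linarith
  have hvol : MeasureTheory.volume (Set.Icc 0 T) ≤ ∑ z ∈ Z, ∑ j ∈ Finset.range (⌊T * z⌋₊ + 2),
      MeasureTheory.volume (Set.Icc ((j - ε) / z) ((j + ε) / z)) :=
    (MeasureTheory.measure_mono hcover).trans <|
      (MeasureTheory.measure_biUnion_finset_le _ _).trans <|
        sum_le_sum fun z _ => MeasureTheory.measure_biUnion_finset_le _ _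
  have hlen : ∀ z ∈ Z, ∀ j : ℕ, 0 ≤ (j + ε) / z - (j - ε) / z := fun z hz j => by
    have := hZ z hz
    rw [← sub_div]
    apply div_nonneg <;> linarith
  simp only [Real.volume_Icc] at hvol
  have hsum : ∑ z ∈ Z, ∑ j ∈ Finset.range (⌊T * z⌋₊ + 2),
      ENNReal.ofReal ((j + ε) / z - (j - ε) / z) =
        ENNReal.ofReal (∑ z ∈ Z, ∑ j ∈ Finset.range (⌊T * z⌋₊ + 2),
          ((j + ε) / z - (j - ε) / z)) := by
    rw [ENNReal.ofReal_sum_of_nonneg fun z hz => sum_nonneg fun j _ => hlen z hz j]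
    exact sum_congr rfl fun z hz =>
      (ENNReal.ofReal_sum_of_nonneg fun j _ => hlen z hz j).symm
  rw [hsum, ENNReal.ofReal_le_ofReal_iff
    (sum_nonneg fun z hz => sum_nonneg fun j _ => hlen z hz j)] at hvol
  have hbound : ∑ z ∈ Z, ∑ j ∈ Finset.range (⌊T * z⌋₊ + 2), ((j + ε) / z - (j - ε) / z) ≤
      ∑ z ∈ Z, (2 * ε * T + 4 * ε / z) := sum_le_sum fun z hz => by
    have hz0 := hZ z hz
    have h1 : ∀ j : ℕ, (j + ε) / z - (j - ε) / z = 2 * ε / z := fun j => by ring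
    simp only [h1, sum_const, card_range, nsmul_eq_mul, Nat.cast_add, Nat.cast_ofNat]
    calc ((⌊T * z⌋₊ : ℝ) + 2) * (2 * ε / z) ≤ (T * z + 2) * (2 * ε / z) := by
          gcongr
          exact Nat.floor_le (by positivity)
      _ = 2 * ε * T + 4 * ε / z := by field_simp; ring
  rw [sum_add_distrib, sum_const, nsmul_eq_mul] at hbound
  nlinarith

lemma card_sub_self_le (A : Finset ℝ) : #(A - A) ≤ 2 * #(diffSet A) + 1 := by
  have hsub : A - A ⊆ diffSet A ∪ (-diffSet A ∪ {0}) := fun x hx => by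
    obtain ⟨a, ha, b, hb, rfl⟩ := Finset.mem_sub.1 hx
    simp only [diffSet, Finset.mem_union, Finset.mem_neg', Finset.mem_filter,
      Finset.mem_singleton]
    rcases lt_trichotomy (a - b) 0 with h | h | h
    · exact Or.inr (Or.inl ⟨by rw [neg_sub]; exact Finset.sub_mem_sub hb ha, by linarith⟩)
    · exact Or.inr (Or.inr h)
    · exact Or.inl ⟨hx, h⟩
  have h1 := card_le_card hsub
  have h2 := card_union_le (diffSet A) (-diffSet A ∪ {0})
  have h3 := card_union_le (-diffSet A) {0}
  rw [card_neg, card_singleton] at h3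
  omega

/-- A finite set of reals with small difference set is dense in a model inside an interval of
integers in which three-term progressions come from three-term progressions. -/
lemma exists_nat_model (A : Finset ℝ) {N : ℕ} (hN : 4 * #(2 • A - 2 • A) < N) :
    ∃ f : ℝ → ℕ, (∀ x, f x < N) ∧
      ∀ x ∈ A, ∀ y ∈ A, ∀ z ∈ A, f x + f z = 2 * f y → x + z = 2 * y := by
  have hN0 : (0 : ℝ) < N := by exact_mod_cast (Nat.zero_le _).trans_lt hN
  set Z : Finset ℝ := ((2 • A - 2 • A).filter (· ≠ 0)).image abs
  have hZ : #Z ≤ #(2 • A - 2 • A) := card_image_le.trans (card_filter_le _ _)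
  rcases A.eq_empty_or_nonempty with rfl | hA
  · exact ⟨fun _ => 0, fun _ => by exact_mod_cast hN0, by simp⟩
  have hpos : 0 < #(2 • A - 2 • A) := card_pos.2 (hA.nsmul.sub hA.nsmul)
  obtain ⟨θ, hθ⟩ := exists_dilate_far_from_int Z (fun z hz => by
      obtain ⟨u, hu, rfl⟩ := Finset.mem_image.1 hz
      exact abs_pos.2 (Finset.mem_filter.1 hu).2) (ε := 2 / N) (by positivity)
    (by
      rw [div_le_one hN0]
      exact_mod_cast (by omega : 2 ≤ N))
    (by
      rw [mul_div_assoc', div_mul_eq_mul_div, div_lt_one hN0]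
      exact_mod_cast (by omega : 2 * 2 * #Z < N))
  refine ⟨fun x => ⌊N * Int.fract (θ * x)⌋₊, fun x => ?_, fun x hx y hy z hz hxyz => ?_⟩
  · rw [Nat.floor_lt (by positivity)]
    nlinarith [Int.fract_lt_one (θ * x)]
  · by_contra hne
    have hu : x + z - 2 * y ≠ 0 := sub_ne_zero.2 hne
    have hmem : |x + z - 2 * y| ∈ Z := by
      refine Finset.mem_image_of_mem _ (Finset.mem_filter.2 ⟨?_, hu⟩)
      rw [two_mul, two_nsmul]
      exact Finset.sub_mem_sub (Finset.add_mem_add hx hz) (Finset.add_mem_add hy hy)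
    have hfar : ∀ j : ℤ, 2 / N ≤ |θ * (x + z - 2 * y) - j| := fun j => by
      rcases abs_choice (x + z - 2 * y) with h | h <;> rw [h] at hmem
      · exact hθ _ hmem j
      · have := hθ _ hmem (-j)
        rwa [← abs_neg, show -(θ * -(x + z - 2 * y) - ((-j : ℤ) : ℝ)) =
          θ * (x + z - 2 * y) - j by push_cast; ring] at this
    have hfl : ∀ t : ℝ, (⌊N * Int.fract t⌋₊ : ℝ) ≤ N * (t - ⌊t⌋) ∧
        N * (t - ⌊t⌋) < ⌊N * Int.fract t⌋₊ + 1 := fun t =>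
      ⟨Nat.floor_le (by positivity), Nat.lt_floor_add_one _⟩
    have h1 := hfl (θ * x)
    have h2 := hfl (θ * y)
    have h3 := hfl (θ * z)
    have h4 : (⌊N * Int.fract (θ * x)⌋₊ : ℝ) + ⌊N * Int.fract (θ * z)⌋₊ =
        2 * ⌊N * Int.fract (θ * y)⌋₊ := by exact_mod_cast hxyz
    have h5 := hfar (⌊θ * x⌋ + ⌊θ * z⌋ - 2 * ⌊θ * y⌋)
    rw [div_le_iff₀ hN0] at h5
    rw [← abs_of_pos hN0] at h5
    rw [← abs_mul] at h5
    refine absurd h5 (not_le.2 ?_)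
    push_cast
    rw [abs_lt]
    constructor <;> nlinarith

lemma card_diffSet_arithmetic_progression_lt {k : ℕ} (hk : 0 < k) (a e : ℝ) :
    #(diffSet ((Finset.range k).image fun j : ℕ => a + j * e)) < k := by
  have hsub : diffSet ((Finset.range k).image fun j : ℕ => a + j * e) ⊆
      (Finset.Ico 1 k).image fun i : ℕ => i * |e| := fun x hx => by
    obtain ⟨hx, hx0⟩ := Finset.mem_filter.1 hx
    obtain ⟨u, hu, v, hv, rfl⟩ := Finset.mem_sub.1 hx
    obtain ⟨i, hi, rfl⟩ := Finset.mem_image.1 hu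
    obtain ⟨j, hj, rfl⟩ := Finset.mem_image.1 hv
    rw [Finset.mem_range] at hi hj
    have hxe : a + i * e - (a + j * e) = ((i : ℝ) - j) * e := by ring
    rw [hxe] at hx0 ⊢
    have hij : i ≠ j := by
      rintro rfl
      simp at hx0
    rw [← abs_of_pos hx0, abs_mul]
    refine Finset.mem_image.2 ⟨max i j - min i j, ?_, ?_⟩
    · rw [Finset.mem_Ico]
      omega
    · congr 1
      rw [Nat.cast_sub (by omega), Nat.cast_max, Nat.cast_min, max_sub_min_eq_abs]
      exact abs_sub_comm _ _
  have := (card_le_card hsub).trans card_image_le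
  rw [Nat.card_Ico] at this
  omega

/-- `g(n,k,k) = ω(n)`: for every `k ≥ 3` and every `c > 0`, for all sufficiently large `n`,
every `n`-element set of reals with the `(k,k)`-local property has more than `c·n`
positive differences. -/
theorem g_n_k_k_superlinear (k : ℕ) (hk : 3 ≤ k) (c : ℝ) (hc : 0 < c) :
    ∃ n₀ : ℕ, ∀ n : ℕ, n₀ ≤ n → ∀ A : Finset ℝ, A.card = n →
      LocalProp A k k → c * n < (diffSet A).card := by
  set K : ℝ := 2 * c + 1 with hK
  have hK1 : 1 ≤ K ^ 4 := one_le_pow₀ (by linarith)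
  obtain ⟨N₀, hN₀⟩ := exists_arithmetic_progression k (δ := 1 / (5 * K ^ 4)) (by positivity)
  refine ⟨N₀ + 1, fun n hn A hA hloc => ?_⟩
  by_contra! hle
  have hn1 : (1 : ℝ) ≤ n := by exact_mod_cast (by omega : 1 ≤ n)
  have hdiff : (#(A - A) : ℝ) ≤ K * n := by
    have : (#(A - A) : ℝ) ≤ 2 * #(diffSet A) + 1 := by exact_mod_cast card_sub_self_le A
    nlinarith
  have hne : A.Nonempty := card_pos.1 (by omega)
  have hplu : (#(2 • A - 2 • A) : ℝ) ≤ K ^ 4 * n := by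
    have h1 := pluennecke_ruzsa_inequality_nsmul_sub_nsmul_sub hne A 2 2
    have h2 : (#(2 • A - 2 • A) : ℝ) ≤ (#(A - A) / #A : ℝ) ^ (2 + 2) * #A := by
      have := NNRat.cast_le (K := ℝ) |>.2 h1
      push_cast at this
      exact this
    rw [hA] at h2
    refine h2.trans ?_
    gcongr
    rwa [div_le_iff₀ (by linarith)]
  set N := ⌊4 * K ^ 4 * n⌋₊ + 1 with hN
  have hN1 : 4 * K ^ 4 * n < N := by
    rw [hN]
    exact_mod_cast Nat.lt_floor_add_one _
  have hN2 : (N : ℝ) ≤ 5 * K ^ 4 * n := by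
    have : (⌊4 * K ^ 4 * n⌋₊ : ℝ) ≤ 4 * K ^ 4 * n := Nat.floor_le (by positivity)
    rw [hN]
    push_cast
    nlinarith
  have hnN : (n : ℝ) ≤ N := by nlinarith
  obtain ⟨f, hfN, hf⟩ := exists_nat_model A (N := N) (by
    have : 4 * (#(2 • A - 2 • A) : ℝ) < N := by linarith
    exact_mod_cast this)
  have hinj : Set.InjOn f A := fun x hx y hy hxy => by
    have := hf x hx y hy y hy (by omega)
    linarith
  obtain ⟨b, d, hd, hbd⟩ := hN₀ N (by
      have : n ≤ N := by exact_mod_cast hnN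
      omega) (A.image f)
    (fun x hx => by
      obtain ⟨y, -, rfl⟩ := Finset.mem_image.1 hx
      exact Finset.mem_range.2 (hfN y))
    (by
      rw [card_image_of_injOn hinj, hA, div_mul_eq_mul_div, one_mul,
        div_le_iff₀ (by positivity)]
      linarith)
  have hpre : ∀ j : ℕ, ∃ x, j ≤ k → x ∈ A ∧ f x = b + j * d := fun j => by
    by_cases hj : j ≤ k
    · obtain ⟨x, hx, hfx⟩ := Finset.mem_image.1 (hbd j hj)
      exact ⟨x, fun _ => ⟨hx, hfx⟩⟩
    · exact ⟨0, fun h => absurd h hj⟩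
  choose x hx using hpre
  have hprog : ∀ j ≤ k, x j = x 0 + j * (x 1 - x 0) := by
    intro j
    induction j using Nat.twoStepInduction with
    | zero => simp
    | one => simp
    | more j ih1 ih2 =>
      intro hj
      have h1 := ih1 (by omega)
      have h2 := ih2 (by omega)
      obtain ⟨ha0, hf0⟩ := hx j (by omega)
      obtain ⟨ha1, hf1⟩ := hx (j + 1) (by omega)
      obtain ⟨ha2, hf2⟩ := hx (j + 2) hj
      have h3 := hf _ ha0 _ ha1 _ ha2 (by rw [hf0, hf1, hf2]; ring)
      push_cast at h2 ⊢
      linarith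
  have he : x 1 - x 0 ≠ 0 := fun h => by
    have h0 := (hx 0 (by omega)).2
    have h1 := (hx 1 (by omega)).2
    rw [sub_eq_zero.1 h] at h1
    omega
  have hcard := hloc ((Finset.range k).image fun j : ℕ => x 0 + j * (x 1 - x 0))
    (fun y hy => by
      obtain ⟨j, hj, rfl⟩ := Finset.mem_image.1 hy
      have hjk : j ≤ k := (Finset.mem_range.1 hj).le
      rw [← hprog j hjk]
      exact (hx j hjk).1)
    (by
      rw [card_image_of_injective, card_range]
      intro i j hij
      exact_mod_cast mul_right_cancel₀ he (add_left_cancel hij))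
  exact absurd hcard (not_le.2 (card_diffSet_arithmetic_progression_lt (by omega) _ _))
end

section
/- For every integer c ≥ 2 and every integer k > (c²+1)², there exist a constant C > 0 and n₀ such that for every integer n ≥ n₀ there exists a set A of n distinct real numbers satisfying the (k, ck+1)-local property with |A - A| ≤ C · n^{1 + (c²+1)/k}. (That is, g(n,k,ck+1) = O(n^{1+(c²+1)/k}).) -/
open Finset Pointwise

/-- The functions on the index set of a family `a` of reals that respect every coincidence
`a i - a j = a p - a q` between differences. -/
def freimanSpace {ι : Type*} (a : ι → ℝ) : Submodule ℝ (ι → ℝ) where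
  carrier := {f | ∀ i j p q, a i - a j = a p - a q → f i - f j = f p - f q}
  zero_mem' := by
    intro i j p q _
    simp
  add_mem' := by
    intro f g hf hg i j p q h
    have h₁ := hf i j p q h
    have h₂ := hg i j p q h
    simp only [Pi.add_apply]
    linarith
  smul_mem' := by
    intro t f hf i j p q h
    have h₁ := hf i j p q h
    simp only [Pi.smul_apply, smul_eq_mul]
    rw [← mul_sub, ← mul_sub, h₁]

theorem mem_freimanSpace {ι : Type*} {a f : ι → ℝ} :
    f ∈ freimanSpace a ↔ ∀ i j p q, a i - a j = a p - a q → f i - f j = f p - f q :=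
  Iff.rfl

/-- Reindexing along `e` as a linear map between spaces of difference-respecting functions. -/
def freimanSpaceComp {ι κ : Type*} (a : ι → ℝ) (e : κ → ι) :
    freimanSpace a →ₗ[ℝ] freimanSpace (a ∘ e) :=
  (LinearMap.funLeft ℝ ℝ e).restrict fun _ hf i j p q h => hf (e i) (e j) (e p) (e q) h

theorem freimanSpaceComp_apply {ι κ : Type*} (a : ι → ℝ) (e : κ → ι) (f : freimanSpace a)
    (i : κ) : (freimanSpaceComp a e f : κ → ℝ) i = (f : ι → ℝ) (e i) :=
  rfl

theorem finrank_freimanSpace_le_comp {ι κ : Type*} [Finite κ] (a : ι → ℝ) {e : κ → ι}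
    (he : Function.Surjective e) :
    Module.finrank ℝ (freimanSpace a) ≤ Module.finrank ℝ (freimanSpace (a ∘ e)) := by
  refine LinearMap.finrank_le_finrank_of_injective (f := freimanSpaceComp a e) ?_
  intro f g h
  ext i
  obtain ⟨j, rfl⟩ := he i
  rw [← freimanSpaceComp_apply, h, freimanSpaceComp_apply]

/-- The dimension of the space of difference-respecting functions on a finite set of reals. -/
noncomputable def freimanRank (A : Finset ℝ) : ℕ :=
  Module.finrank ℝ (freimanSpace (Subtype.val : A → ℝ))

theorem mem_diffSet {A : Finset ℝ} {x : ℝ} :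
    x ∈ diffSet A ↔ ∃ a ∈ A, ∃ b ∈ A, b < a ∧ a - b = x := by
  simp only [diffSet, mem_filter, mem_sub]
  constructor
  · rintro ⟨⟨a, ha, b, hb, rfl⟩, h⟩
    exact ⟨a, ha, b, hb, sub_pos.mp h, rfl⟩
  · rintro ⟨a, ha, b, hb, h, rfl⟩
    exact ⟨⟨a, ha, b, hb, rfl⟩, sub_pos.mpr h⟩

theorem diffSet_mono {A B : Finset ℝ} (h : A ⊆ B) : diffSet A ⊆ diffSet B :=
  filter_subset_filter _ (sub_subset_sub h h)

/-- Deleting the two extreme elements of `A` destroys at least `freimanRank A` differences. -/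
theorem card_diffSet_add_freimanRank_le {A : Finset ℝ} {u v : ℝ} (hu : u ∈ A) (hv : v ∈ A)
    (hmin : ∀ a ∈ A, u ≤ a) (hmax : ∀ a ∈ A, a ≤ v)
    (hB : ((A.erase u).erase v).Nonempty) :
    (diffSet ((A.erase u).erase v)).card + freimanRank A ≤ (diffSet A).card := by
  classical
  set B := (A.erase u).erase v
  have hBA : B ⊆ A := (erase_subset _ _).trans (erase_subset _ _)
  have hBu : ∀ b ∈ B, u < b := fun b hb =>
    lt_of_le_of_ne (hmin b (hBA hb)) (ne_of_mem_erase (mem_of_mem_erase hb)).symm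
  have hBv : ∀ b ∈ B, b < v := fun b hb =>
    lt_of_le_of_ne (hmax b (hBA hb)) (ne_of_mem_erase hb)
  obtain ⟨b₀, hb₀⟩ := hB
  set P : Finset ℝ := A.image (fun a => a - u) ∪ A.image (fun a => v - a)
  set I : Finset ℝ := P.filter (fun x => ¬ ∃ b ∈ B, ∃ b' ∈ B, x = (v - b) + (b' - u))
  have hPdiff : ∀ x ∈ P, ∃ p : A, ∃ q : A, (p : ℝ) - q = x := by
    intro x hx
    rcases mem_union.mp hx with hx | hx <;> obtain ⟨a, ha, rfl⟩ := mem_image.mp hx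
    · exact ⟨⟨a, ha⟩, ⟨u, hu⟩, rfl⟩
    · exact ⟨⟨v, hv⟩, ⟨a, ha⟩, rfl⟩
  have hrank : freimanRank A ≤ I.card := by
    have : Nonempty A := ⟨⟨u, hu⟩⟩
    choose! p q hpq using hPdiff
    let Φ : freimanSpace (Subtype.val : A → ℝ) →ₗ[ℝ] (I → ℝ) :=
      { toFun := fun f x =>
          if (x : ℝ) = 0 then (f : A → ℝ) ⟨u, hu⟩ else (f : A → ℝ) (p x) - (f : A → ℝ) (q x)
        map_add' := by
          intro f g
          ext x
          by_cases hx : (x : ℝ) = 0 <;> simp [hx]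
          ring
        map_smul' := by
          intro t f
          ext x
          by_cases hx : (x : ℝ) = 0 <;> simp [hx]
          ring }
    have hinj : Function.Injective Φ := by
      rw [← LinearMap.ker_eq_bot, LinearMap.ker_eq_bot']
      rintro ⟨f, hf⟩ h0
      have hΦ : ∀ x (hx : x ∈ I),
          (if x = 0 then f ⟨u, hu⟩ else f (p x) - f (q x)) = 0 := fun x hx =>
        congrFun h0 ⟨x, hx⟩
      have h0I : (0 : ℝ) ∈ I := by
        refine mem_filter.mpr ⟨mem_union_left _ (mem_image.mpr ⟨u, hu, sub_self u⟩), ?_⟩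
        rintro ⟨b, hb, b', hb', h⟩
        linarith [hBu b' hb', hBv b hb]
      have hfu : f ⟨u, hu⟩ = 0 := by simpa using hΦ 0 h0I
      have key : ∀ x, x ∈ P → ∀ a b : A, (a : ℝ) - b = x → f a = f b := by
        intro x hx
        refine (P.finite_toSet.wellFoundedOn (r := (· < ·))).induction
          (P := fun x => ∀ a b : A, (a : ℝ) - b = x → f a = f b) hx ?_
        intro x hx ih a b hab
        have transfer : ∀ s t : A, (s : ℝ) - t = x → f s = f t → f a = f b := by
          intro s t hst hfst
          have := hf a b s t (hab.trans hst.symm)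
          linarith
        by_cases hxI : x ∈ I
        · by_cases hx0 : x = 0
          · rw [show a = b from Subtype.ext (by linarith)]
          · have := hΦ x hxI
            rw [if_neg hx0] at this
            exact transfer (p x) (q x) (hpq x hx) (sub_eq_zero.mp this)
        · have hdec : ∃ b ∈ B, ∃ b' ∈ B, x = (v - b) + (b' - u) := by
            by_contra h
            exact hxI (mem_filter.mpr ⟨hx, h⟩)
          obtain ⟨s, hs, t, ht, hst⟩ := hdec
          have h₁ : f ⟨v, hv⟩ = f ⟨s, hBA hs⟩ :=
            ih (v - s) (mem_union_right _ (mem_image_of_mem _ (hBA hs)))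
              (by linarith [hBu t ht]) ⟨v, hv⟩ ⟨s, hBA hs⟩ rfl
          have h₂ : f ⟨t, hBA ht⟩ = f ⟨u, hu⟩ :=
            ih (t - u) (mem_union_left _ (mem_image_of_mem _ (hBA ht)))
              (by linarith [hBv s hs]) ⟨t, hBA ht⟩ ⟨u, hu⟩ rfl
          rcases mem_union.mp hx with hx | hx <;> obtain ⟨y, hy, hyx⟩ := mem_image.mp hx
          · refine transfer ⟨y, hy⟩ ⟨u, hu⟩ hyx ?_
            have := hf ⟨y, hy⟩ ⟨t, hBA ht⟩ ⟨v, hv⟩ ⟨s, hBA hs⟩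
              (by dsimp only at hyx ⊢; linarith)
            linarith
          · refine transfer ⟨v, hv⟩ ⟨y, hy⟩ hyx ?_
            have := hf ⟨s, hBA hs⟩ ⟨y, hy⟩ ⟨t, hBA ht⟩ ⟨u, hu⟩
              (by dsimp only at hyx ⊢; linarith)
            linarith
      have hzero : f = 0 := by
        ext a
        have := key (a - u) (mem_union_left _ (mem_image_of_mem _ a.2)) a ⟨u, hu⟩ rfl
        rw [this, hfu, Pi.zero_apply]
      exact Subtype.ext hzero
    simpa [freimanRank] using LinearMap.finrank_le_finrank_of_injective hinj
  have hsub : diffSet B ∪ I.image (fun x => (v - u) - x) ⊆ diffSet A := by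
    refine union_subset (diffSet_mono hBA) ?_
    intro y hy
    obtain ⟨x, hx, rfl⟩ := mem_image.mp hy
    obtain ⟨hxP, hxI⟩ := mem_filter.mp hx
    have hne : x ≠ v - u := fun h => hxI ⟨b₀, hb₀, b₀, hb₀, by rw [h]; ring⟩
    rw [mem_diffSet]
    rcases mem_union.mp hxP with hx | hx <;> obtain ⟨a, ha, rfl⟩ := mem_image.mp hx
    · refine ⟨v, hv, a, ha, lt_of_le_of_ne (hmax a ha) ?_, by ring⟩
      rintro rfl
      exact hne rfl
    · refine ⟨a, ha, u, hu, lt_of_le_of_ne (hmin a ha) ?_, by ring⟩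
      rintro rfl
      exact hne rfl
  have hdisj : Disjoint (diffSet B) (I.image (fun x => (v - u) - x)) := by
    rw [Finset.disjoint_left]
    intro y hy hy'
    obtain ⟨x, hx, rfl⟩ := mem_image.mp hy'
    obtain ⟨a, ha, b, hb, -, hab⟩ := mem_diffSet.mp hy
    exact (mem_filter.mp hx).2 ⟨a, ha, b, hb, by linarith⟩
  calc (diffSet B).card + freimanRank A
      ≤ (diffSet B).card + (I.image (fun x => (v - u) - x)).card := by
        rw [card_image_of_injective _ sub_right_injective]
        gcongr
    _ = (diffSet B ∪ I.image (fun x => (v - u) - x)).card := (card_union_of_disjoint hdisj).symm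
    _ ≤ (diffSet A).card := card_le_card hsub

/-- If some nonzero difference-respecting function on `A` vanishes off the two extreme elements,
then deleting these elements destroys almost `#A` differences. -/
theorem card_diffSet_add_card_le {A : Finset ℝ} {u v : ℝ} (hu : u ∈ A) (hv : v ∈ A)
    (hmin : ∀ a ∈ A, u ≤ a) (hmax : ∀ a ∈ A, a ≤ v) {f : A → ℝ}
    (hf : f ∈ freimanSpace (Subtype.val : A → ℝ)) (hf0 : f ≠ 0)
    (hfB : ∀ a : A, (a : ℝ) ∈ (A.erase u).erase v → f a = 0) :
    (diffSet ((A.erase u).erase v)).card + ((A.erase u).erase v).card ≤ (diffSet A).card := by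
  classical
  set B := (A.erase u).erase v
  have hBA : B ⊆ A := (erase_subset _ _).trans (erase_subset _ _)
  have hBu : ∀ b ∈ B, u < b := fun b hb =>
    lt_of_le_of_ne (hmin b (hBA hb)) (ne_of_mem_erase (mem_of_mem_erase hb)).symm
  have hBv : ∀ b ∈ B, b < v := fun b hb =>
    lt_of_le_of_ne (hmax b (hBA hb)) (ne_of_mem_erase hb)
  have main : ∀ E : Finset ℝ, E.card = B.card → E ⊆ diffSet A → Disjoint (diffSet B) E →
      (diffSet B).card + B.card ≤ (diffSet A).card := by
    intro E hE hEA hd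
    rw [← hE, ← card_union_of_disjoint hd]
    exact card_le_card (union_subset (diffSet_mono hBA) hEA)
  have huv : f ⟨u, hu⟩ ≠ 0 ∨ f ⟨v, hv⟩ ≠ 0 := by
    by_contra! h
    refine hf0 (funext fun a => ?_)
    by_cases hau : (a : ℝ) = u
    · rw [show a = ⟨u, hu⟩ from Subtype.ext hau, h.1, Pi.zero_apply]
    by_cases hav : (a : ℝ) = v
    · rw [show a = ⟨v, hv⟩ from Subtype.ext hav, h.2, Pi.zero_apply]
    exact hfB a (mem_erase.mpr ⟨hav, mem_erase.mpr ⟨hau, a.2⟩⟩)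
  rcases huv with h | h
  · refine main (B.image fun b => b - u) (card_image_of_injective _ sub_left_injective) ?_ ?_
    · intro y hy
      obtain ⟨b, hb, rfl⟩ := mem_image.mp hy
      exact mem_diffSet.mpr ⟨b, hBA hb, u, hu, hBu b hb, rfl⟩
    · rw [Finset.disjoint_left]
      intro y hy hy'
      obtain ⟨b, hb, rfl⟩ := mem_image.mp hy'
      obtain ⟨s, hs, t, ht, -, hst⟩ := mem_diffSet.mp hy
      have := hf ⟨s, hBA hs⟩ ⟨t, hBA ht⟩ ⟨b, hBA hb⟩ ⟨u, hu⟩ hst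
      rw [hfB ⟨s, hBA hs⟩ hs, hfB ⟨t, hBA ht⟩ ht, hfB ⟨b, hBA hb⟩ hb] at this
      exact h (by linarith)
  · refine main (B.image fun b => v - b) (card_image_of_injective _ sub_right_injective) ?_ ?_
    · intro y hy
      obtain ⟨b, hb, rfl⟩ := mem_image.mp hy
      exact mem_diffSet.mpr ⟨v, hv, b, hBA hb, hBv b hb, rfl⟩
    · rw [Finset.disjoint_left]
      intro y hy hy'
      obtain ⟨b, hb, rfl⟩ := mem_image.mp hy'
      obtain ⟨s, hs, t, ht, -, hst⟩ := mem_diffSet.mp hy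
      have := hf ⟨s, hBA hs⟩ ⟨t, hBA ht⟩ ⟨v, hv⟩ ⟨b, hBA hb⟩ hst
      rw [hfB ⟨s, hBA hs⟩ hs, hfB ⟨t, hBA ht⟩ ht, hfB ⟨b, hBA hb⟩ hb] at this
      exact h (by linarith)

/-- Either deleting the two extreme elements does not decrease the rank, or it decreases it by at
most two and destroys almost `#A` differences. -/
theorem freimanRank_le_or {A : Finset ℝ} {u v : ℝ} (hu : u ∈ A) (hv : v ∈ A)
    (hmin : ∀ a ∈ A, u ≤ a) (hmax : ∀ a ∈ A, a ≤ v) :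
    freimanRank A ≤ freimanRank ((A.erase u).erase v) ∨
      freimanRank A ≤ freimanRank ((A.erase u).erase v) + 2 ∧
        (diffSet ((A.erase u).erase v)).card + ((A.erase u).erase v).card ≤
          (diffSet A).card := by
  classical
  have hBA : (A.erase u).erase v ⊆ A := (erase_subset _ _).trans (erase_subset _ _)
  let ρ : freimanSpace (Subtype.val : A → ℝ) →ₗ[ℝ]
      freimanSpace (Subtype.val : ((A.erase u).erase v : Finset ℝ) → ℝ) :=
    freimanSpaceComp (Subtype.val : A → ℝ)
      (fun b : ((A.erase u).erase v : Finset ℝ) => (⟨b, hBA b.2⟩ : A))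
  have hρ : ∀ f, ρ f = 0 → ∀ a : A, (a : ℝ) ∈ (A.erase u).erase v → (f : A → ℝ) a = 0 := by
    intro f hf a ha
    exact congrFun (congrArg Subtype.val hf) ⟨a, ha⟩
  by_cases hinj : Function.Injective ρ
  · exact Or.inl (LinearMap.finrank_le_finrank_of_injective hinj)
  right
  constructor
  · have hker : Module.finrank ℝ (LinearMap.ker ρ) ≤ 2 := by
      let ψ : LinearMap.ker ρ →ₗ[ℝ] ℝ × ℝ :=
        { toFun := fun f => ((f.1 : A → ℝ) ⟨u, hu⟩, (f.1 : A → ℝ) ⟨v, hv⟩)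
          map_add' := fun _ _ => rfl
          map_smul' := fun _ _ => rfl }
      have hψ : Function.Injective ψ := by
        rintro ⟨f, hf⟩ ⟨g, hg⟩ hfg
        refine Subtype.ext (Subtype.ext (funext fun a => ?_))
        by_cases hau : (a : ℝ) = u
        · rw [show a = ⟨u, hu⟩ from Subtype.ext hau]
          exact congrArg Prod.fst hfg
        by_cases hav : (a : ℝ) = v
        · rw [show a = ⟨v, hv⟩ from Subtype.ext hav]
          exact congrArg Prod.snd hfg
        have ha : (a : ℝ) ∈ (A.erase u).erase v := mem_erase.mpr ⟨hav, mem_erase.mpr ⟨hau, a.2⟩⟩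
        exact (hρ f hf a ha).trans (hρ g hg a ha).symm
      simpa using LinearMap.finrank_le_finrank_of_injective hψ
    have h₁ := LinearMap.finrank_range_add_finrank_ker ρ
    have h₂ := Submodule.finrank_le (LinearMap.range ρ)
    unfold freimanRank
    omega
  · rw [← LinearMap.ker_eq_bot, LinearMap.ker_eq_bot'] at hinj
    push Not at hinj
    obtain ⟨f, hf, hf0⟩ := hinj
    exact card_diffSet_add_card_le hu hv hmin hmax f.2 (fun h => hf0 (Subtype.ext h)) (hρ f hf)

/-- A Freiman-type lower bound for the number of positive differences of a set of large rank. -/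
theorem mul_card_le_two_mul_card_diffSet (A : Finset ℝ) (h : ℕ) (hh : h ≤ freimanRank A) :
    h * A.card ≤ 2 * (diffSet A).card + h ^ 2 := by
  classical
  induction hn : A.card using Nat.strong_induction_on generalizing A h with
  | _ n ih =>
    by_cases hhn : n ≤ h
    · nlinarith
    push Not at hhn
    obtain rfl | hpos := Nat.eq_zero_or_pos h
    · simp
    have hne : A.Nonempty := card_pos.mp (by omega)
    have hu := A.min'_mem hne
    have hv := A.max'_mem hne
    have hmin : ∀ a ∈ A, A.min' hne ≤ a := fun a ha => A.min'_le a ha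
    have hmax : ∀ a ∈ A, a ≤ A.max' hne := fun a ha => A.le_max' a ha
    have hlt : A.min' hne < A.max' hne := A.min'_lt_max'_of_card (by omega)
    generalize A.min' hne = u at *
    generalize A.max' hne = v at *
    by_cases hn2 : n = 2
    · have : 0 < (diffSet A).card :=
        card_pos.mpr ⟨v - u, mem_diffSet.mpr ⟨v, hv, u, hu, hlt, rfl⟩⟩
      obtain rfl : h = 1 := by omega
      subst hn2
      omega
    have hBcard : ((A.erase u).erase v).card = n - 2 := by
      rw [card_erase_of_mem (mem_erase.mpr ⟨hlt.ne', hv⟩), card_erase_of_mem hu]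
      omega
    obtain ⟨t, rfl⟩ : ∃ t, n = t + 3 := ⟨n - 3, by omega⟩
    have hdrop := card_diffSet_add_freimanRank_le hu hv hmin hmax
      (card_pos.mp (by omega))
    rcases freimanRank_le_or hu hv hmin hmax with hr | ⟨hr, hD⟩
    · have := ih _ (by omega) _ h (hh.trans hr) hBcard
      rw [show t + 3 - 2 = t + 1 by omega] at this
      nlinarith
    · rw [hBcard] at hD
      have h₁ := ih _ (by omega) _ (h - 2) (by omega) hBcard
      rw [show t + 3 - 2 = t + 1 by omega] at h₁ hD
      obtain rfl | ⟨s, rfl⟩ : h = 1 ∨ ∃ s, h = s + 2 := by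
        by_cases h1 : h = 1
        · exact Or.inl h1
        · exact Or.inr ⟨h - 2, by omega⟩
      · omega
      · rw [Nat.add_sub_cancel] at h₁
        nlinarith

/-- A subspace of `ι → ℝ` is determined by at most `finrank` many coordinates. -/
theorem exists_determining_coordinates {ι : Type*} [Finite ι] (V : Submodule ℝ (ι → ℝ)) :
    ∃ I : Finset ι, I.card ≤ Module.finrank ℝ V ∧ ∀ x ∈ V, (∀ i ∈ I, x i = 0) → x = 0 := by
  classical
  induction hd : Module.finrank ℝ V using Nat.strong_induction_on generalizing V with
  | _ d ih =>
    by_cases hV : V = ⊥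
    · exact ⟨∅, by simp, fun x hx _ => by simpa [hV] using hx⟩
    obtain ⟨y, hy, hy0⟩ := Submodule.exists_mem_ne_zero_of_ne_bot hV
    obtain ⟨i, hi⟩ := Function.ne_iff.mp hy0
    let W : Submodule ℝ (ι → ℝ) := V ⊓ LinearMap.ker (LinearMap.proj (R := ℝ) (φ := fun _ => ℝ) i)
    have hWV : W < V := by
      refine lt_of_le_of_ne inf_le_left fun h => hi ?_
      have hyW : y ∈ W := h ▸ hy
      exact hyW.2
    have hlt := Submodule.finrank_lt_finrank_of_lt hWV
    obtain ⟨I, hI, hIW⟩ := ih _ (hd ▸ hlt) W rfl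
    refine ⟨insert i I, (card_insert_le _ _).trans (by omega), fun x hx hx0 => ?_⟩
    exact hIW x ⟨hx, hx0 i (mem_insert_self _ _)⟩ fun j hj => hx0 j (mem_insert_of_mem hj)

/-- The real numbers represented by a set of elements of `Fin N`. -/
noncomputable def realImage {N : ℕ} (s : Finset (Fin N)) : Finset ℝ :=
  s.image fun i : Fin N => ((i : ℕ) : ℝ)

theorem natCast_val_injective (N : ℕ) : Function.Injective fun i : Fin N => ((i : ℕ) : ℝ) :=
  fun _ _ h => Fin.ext (Nat.cast_injective h)

theorem card_realImage {N : ℕ} (s : Finset (Fin N)) : (realImage s).card = s.card :=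
  card_image_of_injective _ (natCast_val_injective N)

open Classical in
/-- There are `O(N ^ m)` sets of `k` integers in `[0, N)` of rank at most `m`. -/
theorem card_filter_freimanRank_le (k m N : ℕ) (hN : 0 < N) :
    ((powersetCard k (univ : Finset (Fin N))).filter
      fun s => freimanRank (realImage s) ≤ m).card ≤ N ^ m * 2 ^ k ^ 4 := by
  set H := (powersetCard k (univ : Finset (Fin N))).filter
    fun s => freimanRank (realImage s) ≤ m
  have hex : ∀ s : Finset (Fin N), ∃ e : Fin k → Fin N,
      s.card = k → Function.Injective e ∧ univ.image e = s := by
    intro s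
    by_cases hs : s.card = k
    · exact ⟨s.orderEmbOfFin hs, fun _ => ⟨(s.orderEmbOfFin hs).injective, by simp⟩⟩
    · by_cases hk : k = 0
      · subst hk
        exact ⟨Fin.elim0, fun h => absurd h hs⟩
      · exact ⟨fun _ => ⟨0, hN⟩, fun h => absurd h hs⟩
  choose e he using hex
  let a : Finset (Fin N) → Fin k → ℝ := fun s i => ((e s i : ℕ) : ℝ)
  let pat : Finset (Fin N) → Finset (Fin k × Fin k × Fin k × Fin k) := fun s =>
    univ.filter fun t => a s t.1 - a s t.2.1 = a s t.2.2.1 - a s t.2.2.2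
  have hcard : ∀ s ∈ H, s.card = k := fun s hs => (mem_powersetCard.mp (mem_filter.mp hs).1).2
  have hspace : ∀ s t, pat s = pat t → freimanSpace (a s) = freimanSpace (a t) := by
    intro s t hst
    have hiff : ∀ i j p q, a s i - a s j = a s p - a s q ↔ a t i - a t j = a t p - a t q := by
      intro i j p q
      simpa [pat] using Finset.ext_iff.mp hst (i, j, p, q)
    ext f
    simp only [mem_freimanSpace, hiff]
  have hrank : ∀ s ∈ H, Module.finrank ℝ (freimanSpace (a s)) ≤ m := by
    intro s hs
    obtain ⟨hinj, himg⟩ := he s (hcard s hs)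
    refine le_trans ?_ (mem_filter.mp hs).2
    have hmem : ∀ x : realImage s, ∃ i, a s i = x := by
      rintro ⟨x, hx⟩
      obtain ⟨j, hj, rfl⟩ := mem_image.mp hx
      rw [← himg] at hj
      obtain ⟨i, -, rfl⟩ := mem_image.mp hj
      exact ⟨i, rfl⟩
    choose g hg using hmem
    have hsurj : Function.Surjective g := by
      intro i
      have hi : a s i ∈ realImage s :=
        mem_image_of_mem _ ((Finset.ext_iff.mp himg (e s i)).mp (mem_image_of_mem _ (mem_univ i)))
      exact ⟨⟨a s i, hi⟩, ((natCast_val_injective N).comp hinj) (hg ⟨a s i, hi⟩)⟩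
    have := finrank_freimanSpace_le_comp (a s) hsurj
    rwa [show a s ∘ g = Subtype.val from funext hg] at this
  have hfiber : ∀ P ∈ H.image pat, (H.filter fun s => pat s = P).card ≤ N ^ m := by
    intro P hP
    obtain ⟨s₀, hs₀, rfl⟩ := mem_image.mp hP
    obtain ⟨I, hIcard, hI⟩ := exists_determining_coordinates (freimanSpace (a s₀))
    have hinj : Set.InjOn (fun (s : Finset (Fin N)) (i : I) => e s i)
        (H.filter fun s => pat s = pat s₀ : Finset (Finset (Fin N))) := by
      intro s hs t ht hst
      obtain ⟨hsH, hs⟩ := mem_filter.mp hs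
      obtain ⟨htH, ht⟩ := mem_filter.mp ht
      have hself : ∀ s, a s ∈ freimanSpace (a s) := fun s _ _ _ _ h => h
      have hsub : a s - a t ∈ freimanSpace (a s₀) :=
        Submodule.sub_mem _ (hspace s s₀ hs ▸ hself s) (hspace t s₀ ht ▸ hself t)
      have hzero := hI _ hsub fun i hi => by
        have : e s i = e t i := congrFun hst ⟨i, hi⟩
        simp [a, this]
      have hest : e s = e t := funext fun i =>
        natCast_val_injective N (sub_eq_zero.mp (congrFun hzero i))
      rw [← (he s (hcard s hsH)).2, hest, (he t (hcard t htH)).2]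
    calc (H.filter fun s => pat s = pat s₀).card
        ≤ (univ : Finset (I → Fin N)).card :=
          card_le_card_of_injOn _ (fun _ _ => mem_coe.mpr (mem_univ _)) hinj
      _ = N ^ I.card := by simp
      _ ≤ N ^ m := Nat.pow_le_pow_right hN (hIcard.trans (hrank s₀ hs₀))
  refine (card_le_mul_card_image H _ hfiber).trans ?_
  gcongr
  refine (card_le_univ _).trans (le_of_eq ?_)
  simp only [Fintype.card_finset, Fintype.card_prod, Fintype.card_fin]
  ring_nf

/-- The number of `q`-colourings that give a fixed colour to all of `e`. -/
theorem card_filter_forall_eq_mul {α : Type*} [Fintype α] [DecidableEq α] {q : ℕ} (z : Fin q)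
    (e : Finset α) :
    ((univ : Finset (α → Fin q)).filter fun f => ∀ i ∈ e, f i = z).card * q ^ e.card =
      q ^ Fintype.card α := by
  have h : ((univ : Finset (α → Fin q)).filter fun f => ∀ i ∈ e, f i = z) =
      Fintype.piFinset fun i => if i ∈ e then {z} else univ := by
    ext f
    simp only [mem_filter, mem_univ, true_and, Fintype.mem_piFinset]
    refine forall_congr' fun i => ?_
    by_cases hi : i ∈ e <;> simp [hi]
  rw [h, Fintype.card_piFinset]
  have hcard : ∀ i, (if i ∈ e then ({z} : Finset (Fin q)) else univ).card =
      if i ∈ e then 1 else q := fun i => by split_ifs <;> simp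
  have hq : q ^ e.card = ∏ i, if i ∈ e then q else 1 := by simp
  rw [hq, ← prod_mul_distrib]
  rw [prod_congr rfl (g := fun _ => q)]
  · simp
  · intro i _
    rw [hcard]
    split_ifs <;> simp

/-- The deletion method: a sparse `k`-uniform hypergraph has a large independent set. -/
theorem exists_independent_card_eq {α : Type*} [Fintype α] (H : Finset (Finset α)) {k q n : ℕ}
    (hk : 0 < k) (hq : 0 < q) (hH : ∀ e ∈ H, e.card = k) (hα : Fintype.card α = 2 * n * q)
    (hn : 0 < n) (hE : H.card ≤ n * q ^ k) :
    ∃ T : Finset α, T.card = n ∧ ∀ e ∈ H, ¬ e ⊆ T := by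
  classical
  let z : Fin q := ⟨0, hq⟩
  let S : (α → Fin q) → Finset α := fun f => univ.filter fun i => f i = z
  let F : (α → Fin q) → Finset (Finset α) := fun f => H.filter fun e => ∀ i ∈ e, f i = z
  have hS : ∑ f, (S f).card = 2 * n * q ^ Fintype.card α := by
    have hswap : ∑ f, (S f).card =
        ∑ i : α, ((univ : Finset (α → Fin q)).filter fun f => f i = z).card :=
      sum_card_bipartiteAbove_eq_sum_card_bipartiteBelow (fun (f : α → Fin q) i => f i = z)
    refine Nat.eq_of_mul_eq_mul_right hq ?_
    rw [hswap, sum_mul, sum_congr rfl (g := fun _ => q ^ Fintype.card α)]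
    · rw [sum_const, card_univ, smul_eq_mul, hα]
      ring
    · intro i _
      simpa using card_filter_forall_eq_mul z {i}
  have hF : ∑ f, (F f).card ≤ n * q ^ Fintype.card α := by
    have hswap : ∑ f, (F f).card =
        ∑ e ∈ H, ((univ : Finset (α → Fin q)).filter fun f => ∀ i ∈ e, f i = z).card :=
      sum_card_bipartiteAbove_eq_sum_card_bipartiteBelow (fun (f : α → Fin q) (e : Finset α) => ∀ i ∈ e, f i = z)
    refine Nat.le_of_mul_le_mul_right ?_ (pow_pos hq k)
    rw [hswap, sum_mul, sum_congr rfl (g := fun _ => q ^ Fintype.card α)]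
    · rw [sum_const, smul_eq_mul, mul_right_comm]
      gcongr
    · intro e he
      simpa [hH e he] using card_filter_forall_eq_mul z e
  obtain ⟨f, hf⟩ : ∃ f, n + (F f).card ≤ (S f).card := by
    by_contra! hcon
    have : Nonempty (α → Fin q) := ⟨fun _ => z⟩
    have hlt := sum_lt_sum_of_nonempty (univ_nonempty (α := α → Fin q)) fun f _ => hcon f
    rw [hS, sum_add_distrib, sum_const, card_univ, Fintype.card_fun, Fintype.card_fin,
      smul_eq_mul] at hlt
    nlinarith
  have hne : ∀ e : Finset α, ∃ i, e ∈ H → i ∈ e := by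
    have : Nonempty α := Fintype.card_pos_iff.mp (hα ▸ by positivity)
    intro e
    by_cases he : e ∈ H
    · obtain ⟨i, hi⟩ := card_pos.mp (hH e he ▸ hk)
      exact ⟨i, fun _ => hi⟩
    · exact ⟨Classical.arbitrary α, fun h => absurd h he⟩
  choose p hp using hne
  have hcard : n ≤ (S f \ (F f).image p).card := by
    have h₁ := le_card_sdiff ((F f).image p) (S f)
    have h₂ : ((F f).image p).card ≤ (F f).card := card_image_le
    omega
  obtain ⟨T, hTS, hT⟩ := exists_subset_card_eq hcard
  refine ⟨T, hT, fun e he heT => ?_⟩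
  have heF : e ∈ F f := mem_filter.mpr
    ⟨he, fun i hi => (mem_filter.mp (mem_sdiff.mp (hTS (heT hi))).1).2⟩
  exact (mem_sdiff.mp (hTS (heT (hp e he)))).2 (mem_image_of_mem p heF)

theorem card_diffSet_realImage_le {N : ℕ} (T : Finset (Fin N)) :
    (diffSet (realImage T)).card ≤ N := by
  have hsub : diffSet (realImage T) ⊆ (range N).image fun i : ℕ => (i : ℝ) := by
    intro x hx
    obtain ⟨a, ha, b, hb, hba, rfl⟩ := mem_diffSet.mp hx
    obtain ⟨i, -, rfl⟩ := mem_image.mp ha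
    obtain ⟨j, -, rfl⟩ := mem_image.mp hb
    have hji : (j : ℕ) < i := by exact_mod_cast hba
    exact mem_image.mpr ⟨i - j, mem_range.mpr (by omega), by push_cast [hji.le]; rfl⟩
  calc (diffSet (realImage T)).card ≤ ((range N).image fun i : ℕ => (i : ℝ)).card :=
        card_le_card hsub
    _ ≤ (range N).card := card_image_le
    _ = N := card_range N

/-- A set of `k` reals with at most `c * k` positive differences has rank at most `c ^ 2 + 1`. -/
theorem freimanRank_le_of_card_diffSet_le {c k : ℕ} (hc : 2 ≤ c) (hk : (c ^ 2 + 1) ^ 2 < k)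
    {A : Finset ℝ} (hA : A.card = k) (hD : (diffSet A).card ≤ c * k) :
    freimanRank A ≤ c ^ 2 + 1 := by
  by_contra! h
  have h₁ := mul_card_le_two_mul_card_diffSet A (c ^ 2 + 2) h
  rw [hA] at h₁
  obtain ⟨d, rfl⟩ := Nat.exists_eq_add_of_le hc
  nlinarith [Nat.zero_le (d * k), Nat.zero_le (d ^ 2 * k)]

theorem pow_pred_le_pow_sub {n r m k : ℕ} (hm : 1 ≤ m) (hk : m ^ 2 < k) (hr : n ^ m ≤ r ^ k)
    (hn : 0 < n) : n ^ (m - 1) ≤ r ^ (k - m) := by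
  have hmk : m ≤ k := by nlinarith
  refine le_of_pow_le_pow_left₀ (n := k) (by omega) (Nat.zero_le _) ?_
  calc (n ^ (m - 1)) ^ k = n ^ ((m - 1) * k) := (pow_mul _ _ _).symm
    _ ≤ n ^ (m * (k - m)) := by
      refine Nat.pow_le_pow_right hn ?_
      zify [hm, hmk]
      have : (m : ℤ) ^ 2 < k := by exact_mod_cast hk
      nlinarith
    _ = (n ^ m) ^ (k - m) := pow_mul _ _ _
    _ ≤ (r ^ k) ^ (k - m) := by gcongr
    _ = (r ^ (k - m)) ^ k := by rw [← pow_mul, ← pow_mul, mul_comm]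

/-- `g(n, k, ck+1) = O(n^{1 + (c²+1)/k})` for every integer `c ≥ 2` and `k > (c²+1)²`. -/
theorem g_upper_probabilistic (c k : ℕ) (hc : 2 ≤ c) (hk : (c ^ 2 + 1) ^ 2 < k) :
    ∃ C : ℝ, 0 < C ∧ ∃ n₀ : ℕ, ∀ n : ℕ, n₀ ≤ n →
      ∃ A : Finset ℝ, A.card = n ∧ LocalProp A k (c * k + 1) ∧
        ((diffSet A).card : ℝ) ≤ C * (n : ℝ) ^ ((1 : ℝ) + ((c : ℝ) ^ 2 + 1) / (k : ℝ)) := by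
  classical
  set m := c ^ 2 + 1 with hm
  have hm1 : 1 ≤ m := by omega
  have hmk : m < k := by nlinarith
  have hk0 : 0 < k := by omega
  have hmR : (c : ℝ) ^ 2 + 1 = m := by rw [hm]; push_cast; ring
  rw [hmR]
  set K : ℕ := 2 ^ k ^ 4 * 2 ^ m with hK
  refine ⟨4 * K, by positivity, 1, fun n hn => ?_⟩
  have hnR : (1 : ℝ) ≤ n := by exact_mod_cast hn
  set y : ℝ := (n : ℝ) ^ ((m : ℝ) / k) with hy
  have hy1 : 1 ≤ y := Real.one_le_rpow hnR (by positivity)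
  set r : ℕ := ⌈y⌉₊
  have hyr : y ≤ r := Nat.le_ceil y
  have hry : (r : ℝ) ≤ 2 * y := by
    have := Nat.ceil_lt_add_one (zero_le_one.trans hy1)
    linarith
  have hr1 : 0 < r := Nat.ceil_pos.mpr (by linarith)
  have hrk : n ^ m ≤ r ^ k := by
    have hyk : y ^ k = (n : ℝ) ^ m := by
      rw [hy, ← Real.rpow_natCast, ← Real.rpow_mul (by positivity),
        div_mul_cancel₀ _ (by positivity), Real.rpow_natCast]
    have : (n : ℝ) ^ m ≤ (r : ℝ) ^ k := by
      rw [← hyk]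
      gcongr
    exact_mod_cast this
  set q := K * r with hq
  have hq0 : 0 < q := by positivity
  set N := 2 * n * q with hN
  have hN0 : 0 < N := by positivity
  set H := (powersetCard k (univ : Finset (Fin N))).filter
    fun s => freimanRank (realImage s) ≤ m
  have hHcard : H.card ≤ n * q ^ k := by
    have hpow : K * n ^ (m - 1) ≤ q ^ (k - m) := by
      rw [hq, mul_pow]
      exact Nat.mul_le_mul (Nat.le_self_pow (by omega) K) (pow_pred_le_pow_sub hm1 hk hrk hn)
    calc H.card ≤ N ^ m * 2 ^ k ^ 4 := card_filter_freimanRank_le k m N hN0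
      _ = K * (n * n ^ (m - 1)) * q ^ m := by
        rw [← pow_succ', Nat.sub_add_cancel hm1, hN, hK, mul_pow, mul_pow]
        generalize 2 ^ k ^ 4 = x
        ring
      _ = n * ((K * n ^ (m - 1)) * q ^ m) := by ring
      _ ≤ n * (q ^ (k - m) * q ^ m) := by gcongr
      _ = n * q ^ k := by rw [← pow_add, Nat.sub_add_cancel hmk.le]
  obtain ⟨T, hT, hTH⟩ := exists_independent_card_eq H hk0 hq0
    (fun e he => (mem_powersetCard.mp (mem_filter.mp he).1).2) (Fintype.card_fin N) hn hHcard
  refine ⟨realImage T, (card_realImage T).trans hT, ?_, ?_⟩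
  · intro A' hA' hcard
    by_contra! hlt
    obtain ⟨s, hs, rfl⟩ := subset_image_iff.mp hA'
    refine hTH s (mem_filter.mpr ⟨mem_powersetCard.mpr ⟨subset_univ s, ?_⟩, ?_⟩)
      (by exact_mod_cast hs)
    · rw [← card_realImage s]
      exact hcard
    · exact freimanRank_le_of_card_diffSet_le hc hk hcard (Nat.lt_succ_iff.mp hlt)
  · calc ((diffSet (realImage T)).card : ℝ) ≤ N := by
          exact_mod_cast card_diffSet_realImage_le T
      _ = 2 * n * (K * r) := by rw [hN, hq]; push_cast; ring
      _ ≤ 2 * n * (K * (2 * y)) := by gcongr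
      _ = 4 * K * (n : ℝ) ^ ((1 : ℝ) + (m : ℝ) / k) := by
        rw [Real.rpow_add (by linarith), Real.rpow_one, ← hy]
        ring
end

section
/- For every integer m ≥ 3, setting k = 2^m, there exist a constant c > 0 and n₀ such that for every integer n ≥ n₀, every set A of n distinct real numbers satisfying the (k, (3^m + 1)/2)-local property has |A - A| ≥ c · n^{1 + 2/(k-2)}. (Since k^{log₂ 3} = 3^m, this says g(n, k, (k^{log₂3}+1)/2) = Ω(n^{1 + 2/(k-2)}) for k ≥ 8 a power of two.) -/
open Finset Pointwise

/-- A popular difference outside a small forbidden set. -/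
lemma exists_popular_difference {A B F : Finset ℝ} (hBA : B ⊆ A) (hB : B.Nonempty)
    (hF : 2 * F.card ≤ B.card) :
    ∃ d, d ∉ F ∧ B.card ^ 2 ≤ 2 * (A - A).card * (B.filter (fun b => b + d ∈ B)).card := by
  by_contra! h
  set M := (A - A).card with hM
  set fib : ℝ → Finset (ℝ × ℝ) := fun d => (B ×ˢ B).filter (fun p => p.2 - p.1 = d) with hfib
  have hmaps : ∀ p ∈ B ×ˢ B, p.2 - p.1 ∈ A - A := fun p hp =>
    sub_mem_sub (hBA (mem_product.1 hp).2) (hBA (mem_product.1 hp).1)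
  have hsum : B.card ^ 2 = ∑ d ∈ A - A, (fib d).card := by
    rw [sq, ← card_product]
    exact card_eq_sum_card_fiberwise hmaps
  have hle : ∀ d, (fib d).card ≤ (B.filter (fun b => b + d ∈ B)).card := by
    intro d
    refine card_le_card_of_injOn Prod.fst ?_ ?_
    · intro p hp
      simp only [hfib, mem_coe, mem_filter, mem_product] at hp ⊢
      refine ⟨hp.1.1, ?_⟩
      rw [← hp.2, add_sub_cancel]
      exact hp.1.2
    · intro p hp q hq hpq
      simp only [hfib, mem_coe, mem_filter, mem_product] at hp hq
      refine Prod.ext hpq ?_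
      have h1 := hp.2
      have h2 := hq.2
      linarith
  have hBpos : 0 < B.card := hB.card_pos
  have hMpos : 0 < M := by
    obtain ⟨b, hb⟩ := hB
    exact card_pos.2 ⟨b - b, sub_mem_sub (hBA hb) (hBA hb)⟩
  have hterm : ∀ d ∈ A - A, 2 * M * (fib d).card + 1 ≤
      B.card ^ 2 + if d ∈ F then 2 * M * B.card else 0 := by
    intro d _
    split_ifs with hd
    · have h1 : (fib d).card ≤ B.card := (hle d).trans (card_filter_le _ _)
      have h2 : 2 * M * (fib d).card ≤ 2 * M * B.card := Nat.mul_le_mul_left _ h1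
      have h3 : 0 < B.card ^ 2 := by positivity
      omega
    · have h1 := h d hd
      have h2 : 2 * M * (fib d).card ≤ 2 * M * (B.filter (fun b => b + d ∈ B)).card :=
        Nat.mul_le_mul_left _ (hle d)
      omega
  have htotal := sum_le_sum hterm
  rw [sum_add_distrib, sum_add_distrib, ← mul_sum, ← hsum, ← sum_filter] at htotal
  simp only [sum_const, smul_eq_mul, mul_one, ← hM] at htotal
  have hcard : ((A - A).filter (· ∈ F)).card ≤ F.card :=
    card_le_card fun x hx => (mem_filter.1 hx).2
  have h1 : ((A - A).filter (· ∈ F)).card * (2 * M * B.card) ≤ M * B.card ^ 2 := by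
    calc _ ≤ F.card * (2 * M * B.card) := Nat.mul_le_mul_right _ hcard
      _ = (2 * F.card) * (M * B.card) := by ring
      _ ≤ B.card * (M * B.card) := Nat.mul_le_mul_right _ hF
      _ = _ := by ring
  nlinarith

/-- Adjoining a translate at most triples the size of the difference set. -/
lemma card_sub_union_translate_le (Q : Finset ℝ) (d : ℝ) :
    ((Q ∪ Q.image (· + d)) - (Q ∪ Q.image (· + d))).card ≤ 3 * (Q - Q).card := by
  have hsub : (Q ∪ Q.image (· + d)) - (Q ∪ Q.image (· + d)) ⊆
      (Q - Q) ∪ ((Q - Q).image (· + d) ∪ (Q - Q).image (· - d)) := by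
    intro x hx
    obtain ⟨y, hy, z, hz, rfl⟩ := mem_sub.1 hx
    simp only [mem_union, mem_image] at hy hz ⊢
    rcases hy with hy | ⟨y, hy, rfl⟩ <;> rcases hz with hz | ⟨z, hz, rfl⟩
    · exact Or.inl (sub_mem_sub hy hz)
    · exact Or.inr (Or.inr ⟨y - z, sub_mem_sub hy hz, by ring⟩)
    · exact Or.inr (Or.inl ⟨y - z, sub_mem_sub hy hz, by ring⟩)
    · exact Or.inl (by simpa using sub_mem_sub hy hz)
  have h1 := card_le_card hsub
  have h2 := card_union_le (Q - Q) ((Q - Q).image (· + d) ∪ (Q - Q).image (· - d))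
  have h3 := card_union_le ((Q - Q).image (· + d)) ((Q - Q).image (· - d))
  have h4 : ((Q - Q).image (· + d)).card ≤ (Q - Q).card := card_image_le
  have h5 : ((Q - Q).image (· - d)).card ≤ (Q - Q).card := card_image_le
  omega

/-- A set with few differences contains many translates of a nondegenerate cube. -/
lemma exists_cube {A : Finset ℝ} (hA : A.Nonempty) (m : ℕ)
    (hlarge : (2 * 3 ^ m : ℝ) ≤
      2 * (A - A).card * ((A.card : ℝ) / (2 * (A - A).card)) ^ 2 ^ (m - 1)) (i : ℕ) (hi : i ≤ m) :
    ∃ Q B : Finset ℝ, B ⊆ A ∧ Q.card = 2 ^ i ∧ (Q - Q).card ≤ 3 ^ i ∧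
      (∀ b ∈ B, ∀ q ∈ Q, b + q ∈ A) ∧
      2 * ((A - A).card : ℝ) * ((A.card : ℝ) / (2 * (A - A).card)) ^ 2 ^ i ≤ B.card := by
  have hMpos : (0 : ℝ) < (A - A).card := by exact_mod_cast (hA.sub hA).card_pos
  have hnM : (A.card : ℝ) ≤ (A - A).card := by
    exact_mod_cast (card_le_card_sub_right hA : A.card ≤ (A - A).card)
  set M : ℝ := ((A - A).card : ℝ) with hM
  set x : ℝ := (A.card : ℝ) / (2 * M) with hx
  have hx0 : 0 ≤ x := by positivity
  have hx1 : x ≤ 1 := by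
    rw [hx, div_le_one (by positivity)]
    linarith
  induction i with
  | zero =>
    refine ⟨{0}, A, Subset.rfl, by simp, by simp, by simp, ?_⟩
    rw [pow_zero, pow_one, hx, mul_div_cancel₀ _ (by positivity)]
  | succ i ih =>
    obtain ⟨Q, B, hBA, hQ, hQQ, hQA, hB⟩ := ih (by omega)
    have hBlarge : (2 * 3 ^ m : ℝ) ≤ B.card := by
      refine hlarge.trans (le_trans ?_ hB)
      refine mul_le_mul_of_nonneg_left ?_ (by positivity)
      exact pow_le_pow_of_le_one hx0 hx1 (Nat.pow_le_pow_right (by norm_num) (by omega))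
    have hBlarge' : 2 * 3 ^ m ≤ B.card := by exact_mod_cast hBlarge
    have h3 : 3 ^ i ≤ 3 ^ m := Nat.pow_le_pow_right (by norm_num) (by omega)
    have h3pos : 0 < 3 ^ m := by positivity
    obtain ⟨d, hd, hpop⟩ := exists_popular_difference (F := Q - Q) hBA
      (card_pos.1 (by omega)) (by omega)
    refine ⟨Q ∪ Q.image (· + d), B.filter (fun b => b + d ∈ B),
      (filter_subset _ _).trans hBA, ?_, ?_, ?_, ?_⟩
    · rw [card_union_of_disjoint, card_image_of_injective _ (add_left_injective d), hQ]
      · ring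
      · rw [disjoint_left]
        intro y hy hy'
        obtain ⟨z, hz, rfl⟩ := mem_image.1 hy'
        exact hd (by simpa using sub_mem_sub hy hz)
    · refine (card_sub_union_translate_le Q d).trans ?_
      rw [pow_succ]
      omega
    · intro b hb q hq
      obtain ⟨hb, hbd⟩ := mem_filter.1 hb
      rcases mem_union.1 hq with hq | hq
      · exact hQA b hb q hq
      · obtain ⟨p, hp, rfl⟩ := mem_image.1 hq
        have h := hQA _ hbd p hp
        rwa [add_assoc, add_comm d p] at h
    · have hpop' : (B.card : ℝ) ^ 2 ≤ 2 * M * (B.filter (fun b => b + d ∈ B)).card := by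
        rw [hM]
        exact_mod_cast hpop
      have hsq : (2 * M * x ^ 2 ^ i) ^ 2 ≤ (B.card : ℝ) ^ 2 :=
        pow_le_pow_left₀ (by positivity) hB 2
      have hM2 : 0 < 2 * M := by positivity
      refine le_of_mul_le_mul_left (le_trans (le_of_eq ?_) (hsq.trans hpop')) hM2
      rw [pow_succ 2 i, pow_mul]
      ring

/-- Counting differences of both signs, together with zero. -/
lemma card_sub_self_eq {A : Finset ℝ} (hA : A.Nonempty) :
    (A - A).card = 2 * (diffSet A).card + 1 := by
  have hneg : ((A - A).filter (fun x => x < 0)).card = (diffSet A).card := by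
    refine card_bij (fun x _ => -x) ?_ ?_ ?_
    · intro x hx
      obtain ⟨hx, hx0⟩ := mem_filter.1 hx
      obtain ⟨y, hy, z, hz, rfl⟩ := mem_sub.1 hx
      exact mem_filter.2 ⟨mem_sub.2 ⟨z, hz, y, hy, by ring⟩, by linarith⟩
    · intro x _ y _ h
      exact neg_injective h
    · intro x hx
      obtain ⟨hx, hx0⟩ := mem_filter.1 hx
      obtain ⟨y, hy, z, hz, rfl⟩ := mem_sub.1 hx
      exact ⟨z - y, mem_filter.2 ⟨sub_mem_sub hz hy, by linarith⟩, by ring⟩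
  have hzero : ((A - A).filter (fun x => x = 0)).card = 1 := by
    obtain ⟨a, ha⟩ := hA
    refine card_eq_one.2 ⟨0, ?_⟩
    ext x
    simp only [mem_filter, mem_singleton, and_iff_right_iff_imp]
    rintro rfl
    exact mem_sub.2 ⟨a, ha, a, ha, sub_self a⟩
  have h1 := card_filter_add_card_filter_not (s := A - A) (fun x => 0 < x)
  have h2 := card_filter_add_card_filter_not (s := (A - A).filter (fun x => ¬ 0 < x))
    (fun x => x < 0)
  rw [filter_filter, filter_filter] at h2
  have h3 : (A - A).filter (fun x => ¬ 0 < x ∧ x < 0) = (A - A).filter (fun x => x < 0) :=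
    filter_congr fun x _ => ⟨fun h => h.2, fun h => ⟨h.le.not_gt, h⟩⟩
  have h4 : (A - A).filter (fun x => ¬ 0 < x ∧ ¬ x < 0) = (A - A).filter (fun x => x = 0) :=
    filter_congr fun x _ => ⟨fun h => le_antisymm (not_lt.1 h.1) (not_lt.1 h.2),
      fun h => by simp [h]⟩
  rw [h3, h4, hneg, hzero] at h2
  have h5 : (diffSet A).card = ((A - A).filter (fun x => 0 < x)).card := rfl
  omega

/-- The local property excludes cubes, so the difference set is large. -/
lemma LocalProp.card_pow_lt {A : Finset ℝ} (hA : A.Nonempty) {m : ℕ}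
    (h : LocalProp A (2 ^ m) ((3 ^ m + 1) / 2)) :
    2 * ((A - A).card : ℝ) * ((A.card : ℝ) / (2 * (A - A).card)) ^ 2 ^ (m - 1) < 2 * 3 ^ m := by
  by_contra! hlarge
  obtain ⟨Q, B, -, hQ, hQQ, hQA, hB⟩ := exists_cube hA m hlarge m le_rfl
  have hMpos : (0 : ℝ) < (A - A).card := by exact_mod_cast (hA.sub hA).card_pos
  have hnpos : (0 : ℝ) < A.card := by exact_mod_cast hA.card_pos
  have hBpos : (0 : ℝ) < B.card := lt_of_lt_of_le (by positivity) hB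
  obtain ⟨b, hb⟩ := card_pos.1 (by exact_mod_cast hBpos : 0 < B.card)
  have hcard : (Q.image (b + ·)).card = 2 ^ m := by
    rw [card_image_of_injective _ (add_right_injective b), hQ]
  have hsub : Q.image (b + ·) ⊆ A := by
    intro y hy
    obtain ⟨q, hq, rfl⟩ := mem_image.1 hy
    exact hQA b hb q hq
  have hdiff : Q.image (b + ·) - Q.image (b + ·) ⊆ Q - Q := by
    intro x hx
    obtain ⟨y, hy, z, hz, rfl⟩ := mem_sub.1 hx
    obtain ⟨p, hp, rfl⟩ := mem_image.1 hy
    obtain ⟨q, hq, rfl⟩ := mem_image.1 hz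
    rw [add_sub_add_left_eq_sub]
    exact sub_mem_sub hp hq
  have h1 := h _ hsub hcard
  have h2 := card_sub_self_eq (A := Q.image (b + ·)) (card_pos.1 (by rw [hcard]; positivity))
  have h3 := card_le_card hdiff
  have h4 : Odd (3 ^ m) := Odd.pow (by decide)
  obtain ⟨r, hr⟩ := h4
  omega

/-- For `k = 2^m ≥ 8` a power of two,
`g(n, k, (k^{log₂3}+1)/2) = g(n, 2^m, (3^m+1)/2) = Ω(n^{1 + 2/(k-2)})`. -/
theorem g_lower_cube (m : ℕ) (hm : 3 ≤ m) :
    ∃ c : ℝ, 0 < c ∧ ∃ n₀ : ℕ, ∀ n : ℕ, n₀ ≤ n →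
      ∀ A : Finset ℝ, A.card = n → LocalProp A (2 ^ m) ((3 ^ m + 1) / 2) →
        c * (n : ℝ) ^ ((1 : ℝ) + 2 / ((2 ^ m : ℝ) - 2)) ≤ (diffSet A).card := by
  refine ⟨1 / (6 * (2 * 3 ^ m)), by positivity, 2, ?_⟩
  rintro n hn A rfl hloc
  have hA : A.Nonempty := card_pos.1 (by omega)
  have hlt := hloc.card_pow_lt hA
  have hMD := card_sub_self_eq hA
  have hnM : A.card ≤ (A - A).card := card_le_card_sub_right hA
  have hM3 : ((A - A).card : ℝ) ≤ 3 * (diffSet A).card := by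
    have : (A - A).card ≤ 3 * (diffSet A).card := by omega
    exact_mod_cast this
  have hMpos : (0 : ℝ) < (A - A).card := by exact_mod_cast (hA.sub hA).card_pos
  obtain ⟨e, he⟩ : ∃ e, 2 ^ (m - 1) = e + 1 :=
    ⟨2 ^ (m - 1) - 1, (Nat.sub_add_cancel Nat.one_le_two_pow).symm⟩
  have he1 : 1 ≤ e := by
    have : 2 ^ 1 ≤ 2 ^ (m - 1) := Nat.pow_le_pow_right (by norm_num) (by omega)
    omega
  have hkR : (2 ^ m : ℝ) - 2 = 2 * e := by
    have h1 : 2 ^ m = 2 * (e + 1) := by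
      rw [← he, ← pow_succ', Nat.sub_add_cancel (by omega)]
    have h2 : (2 ^ m : ℝ) = 2 * (e + 1) := by exact_mod_cast h1
    rw [h2]
    ring
  have heR : (0 : ℝ) < e := by exact_mod_cast he1
  rw [he] at hlt
  set n : ℝ := (A.card : ℝ)
  set M : ℝ := ((A - A).card : ℝ)
  set D : ℝ := ((diffSet A).card : ℝ)
  set T : ℝ := 2 * 3 ^ m with hT
  have hT1 : 1 ≤ T := by
    have : (1 : ℝ) ≤ 3 ^ m := one_le_pow₀ (by norm_num)
    linarith
  have hn0 : 0 ≤ n := Nat.cast_nonneg _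
  have hD0 : 0 ≤ D := Nat.cast_nonneg _
  have hpow : n ^ (e + 1) ≤ T * (6 * D) ^ e := by
    have h1 : 2 * M * (n / (2 * M)) ^ (e + 1) = n ^ (e + 1) / (2 * M) ^ e := by
      rw [div_pow, pow_succ (2 * M)]
      field_simp
    rw [h1, div_lt_iff₀ (by positivity)] at hlt
    have h2 : 2 * M ≤ 6 * D := by linarith
    exact hlt.le.trans (mul_le_mul_of_nonneg_left
      (pow_le_pow_left₀ (by positivity) h2 e) (by positivity))
  have hrpow : (n ^ ((1 : ℝ) + 2 / ((2 ^ m : ℝ) - 2))) ^ e = n ^ (e + 1) := by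
    rw [hkR, ← Real.rpow_natCast, ← Real.rpow_mul hn0, ← Real.rpow_natCast n]
    congr 1
    push_cast
    field_simp
  rw [one_div, inv_mul_le_iff₀ (by positivity)]
  refine le_of_pow_le_pow_left₀ (by omega : e ≠ 0) (by positivity) ?_
  rw [hrpow]
  refine hpow.trans ?_
  have hTe : T ≤ T ^ e := le_self_pow₀ hT1 (by omega)
  calc T * (6 * D) ^ e ≤ T ^ e * (6 * D) ^ e := by gcongr
    _ = (6 * T * D) ^ e := by rw [← mul_pow]; ring
end
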